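/- arXiv:2503.06830 — 2 statements merged into one kernel-verified Lean document; each statement's English description precedes it below -/
import Mathlib

section
/- Let M=(E,r_M) be a q-matroid and let E' be a vector space over F_q containing E with dim E' = dim E + 1. The map that assigns to each one-dimensional extension N=(E',r_N) of M the function μ_N given by μ_N(e) = {F ∈ F_M : F + e is a flat of N and r_N(F + e) = r_N(F)} for each one-dimensional subspace e of E' not contained in E, is a bijection from the set of one-dimensional extensions of M to E' onto the set of modular cut selectors of M. -/
open Module Submodule

variable {K V V₁ V₂ : Type*}

section Defs

variable [Field K] [AddCommGroup V] [Module K V]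

/-- A one-dimensional subspace. -/
def OneDim (x : Submodule K V) : Prop := Module.finrank K x = 1

/-- The q-matroid rank axioms (R1), (R2), (R3) for a rank function on the
lattice of subspaces of `V`. -/
def IsQMatroid (r : Submodule K V → ℕ) : Prop :=
  (∀ X : Submodule K V, r X ≤ Module.finrank K X) ∧
  (∀ X Y : Submodule K V, X ≤ Y → r X ≤ r Y) ∧
  (∀ X Y : Submodule K V, r (X ⊔ Y) + r (X ⊓ Y) ≤ r X + r Y)

/-- The closure of `X`: the sum of all one-dimensional subspaces `x`
with `r (X + x) = r X`. -/
def qcl (r : Submodule K V → ℕ) (X : Submodule K V) : Submodule K V :=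
  sSup {x : Submodule K V | OneDim x ∧ r (X ⊔ x) = r X}

/-- `F` is a flat: adding any one-dimensional subspace not contained in `F`
increases the rank. -/
def IsFlat (r : Submodule K V → ℕ) (F : Submodule K V) : Prop :=
  ∀ x : Submodule K V, OneDim x → ¬ x ≤ F → r F < r (F ⊔ x)

/-- `(F₁, F₂)` is a modular pair. -/
def ModularPair (r : Submodule K V → ℕ) (F₁ F₂ : Submodule K V) : Prop :=
  r (F₁ ⊔ F₂) + r (F₁ ⊓ F₂) = r F₁ + r F₂

/-- A modular cut: a collection of flats satisfying (M1) and (M2). -/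
def IsModularCut (r : Submodule K V → ℕ) (M : Set (Submodule K V)) : Prop :=
  (∀ F ∈ M, IsFlat r F) ∧
  (∀ F ∈ M, ∀ F' : Submodule K V, IsFlat r F' → F ≤ F' → F' ∈ M) ∧
  (∀ F₁ ∈ M, ∀ F₂ ∈ M, ModularPair r F₁ F₂ → F₁ ⊓ F₂ ∈ M)

/-- `Δ_q(V, W)`: the set of one-dimensional subspaces of `V` not contained
in the subspace `W`. -/
def Delta (W : Submodule K V) : Set (Submodule K V) :=
  {e : Submodule K V | OneDim e ∧ ¬ e ≤ W}

/-- A modular cut selector for a q-matroid `rM` on `W` (with respect to the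
ambient space `V`): every value is a modular cut, and property (QM) holds. -/
def IsMCS (W : Submodule K V) (rM : Submodule K ↥W → ℕ)
    (μ : Delta W → Set (Submodule K ↥W)) : Prop :=
  (∀ e : Delta W, IsModularCut rM (μ e)) ∧
  (∀ e₁ e₂ : Delta W, ∀ F ∈ μ e₁,
    (Submodule.map W.subtype F ⊔ (e₁ : Submodule K V) =
      Submodule.map W.subtype F ⊔ (e₂ : Submodule K V) ↔ F ∈ μ e₂))

/-- `B` is a basis of the q-matroid with rank function `r`:
`r B = dim B = r ⊤`. -/
def IsBasisOf (r : Submodule K V → ℕ) (B : Submodule K V) : Prop :=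
  r B = Module.finrank K B ∧ Module.finrank K B = r ⊤

end Defs

section RankFunction

variable [Field K] [AddCommGroup V] [Module K V]

/-- The largest subspace containing `X` with the same rank. -/
def rankClosure (r : Submodule K V → ℕ) (X : Submodule K V) : Submodule K V :=
  sSup {Y : Submodule K V | X ≤ Y ∧ r Y = r X}

theorem IsQMatroid.rank_sup_eq {r : Submodule K V → ℕ} (hr : IsQMatroid r)
    {X Y Z : Submodule K V} (hXY : X ≤ Y) (h : r Y = r X) (hXZ : X ≤ Z) :
    r (Y ⊔ Z) = r Z := by
  have h₁ := hr.2.2 Y Z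
  have h₂ := hr.2.1 X (Y ⊓ Z) (le_inf hXY hXZ)
  have h₃ := hr.2.1 Z (Y ⊔ Z) le_sup_right
  omega

theorem le_rankClosure_of_rank_eq {r : Submodule K V → ℕ} {X Y : Submodule K V}
    (hXY : X ≤ Y) (h : r Y = r X) : Y ≤ rankClosure r X :=
  le_sSup ⟨hXY, h⟩

theorem le_rankClosure (r : Submodule K V → ℕ) (X : Submodule K V) : X ≤ rankClosure r X :=
  le_rankClosure_of_rank_eq le_rfl rfl

theorem oneDim_span_singleton {v : V} (hv : v ≠ 0) : OneDim (K ∙ v) :=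
  finrank_span_singleton hv

theorem exists_oneDim_le_not_le {X Y : Submodule K V} (h : ¬ X ≤ Y) :
    ∃ x : Submodule K V, OneDim x ∧ x ≤ X ∧ ¬ x ≤ Y := by
  obtain ⟨v, hvX, hvY⟩ := SetLike.not_le_iff_exists.1 h
  refine ⟨K ∙ v, oneDim_span_singleton ?_, ?_, ?_⟩
  · rintro rfl
    exact hvY Y.zero_mem
  · simpa using hvX
  · simpa using hvY

theorem IsFlat.le_of_rank_le {r : Submodule K V → ℕ} (hr : IsQMatroid r)
    {F Y : Submodule K V} (hF : IsFlat r F) (hFY : F ≤ Y) (h : r Y ≤ r F) : Y ≤ F := by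
  by_contra hY
  obtain ⟨x, hx, hxY, hxF⟩ := exists_oneDim_le_not_le hY
  have h₁ := hF x hx hxF
  have h₂ := hr.2.1 _ _ (sup_le hFY hxY)
  omega

theorem IsFlat.inf {r : Submodule K V → ℕ} (hr : IsQMatroid r)
    {F G : Submodule K V} (hF : IsFlat r F) (hG : IsFlat r G) : IsFlat r (F ⊓ G) := by
  intro x hx hxFG
  by_contra h
  have h₀ : r (F ⊓ G ⊔ x) = r (F ⊓ G) :=
    le_antisymm (not_lt.1 h) (hr.2.1 _ _ le_sup_left)
  have key : ∀ H : Submodule K V, IsFlat r H → F ⊓ G ≤ H → x ≤ H := by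
    intro H hH hle
    have h₁ := hr.rank_sup_eq le_sup_left h₀ hle
    exact (le_sup_right.trans le_sup_left).trans (hH.le_of_rank_le hr le_sup_right h₁.le)
  exact hxFG (le_inf (key F hF inf_le_left) (key G hG inf_le_right))

variable [FiniteDimensional K V] {r : Submodule K V → ℕ}

theorem IsQMatroid.rank_rankClosure (hr : IsQMatroid r) (X : Submodule K V) :
    r (rankClosure r X) = r X := by
  obtain ⟨Y, ⟨hXY, hY⟩, hmax⟩ := wellFounded_gt.has_min
    {Y : Submodule K V | X ≤ Y ∧ r Y = r X} ⟨X, le_rfl, rfl⟩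
  have hclosure : rankClosure r X = Y := by
    refine le_antisymm (sSup_le fun Z hZ => ?_) (le_rankClosure_of_rank_eq hXY hY)
    by_contra hZY
    exact hmax (Z ⊔ Y)
      ⟨hXY.trans le_sup_right, (hr.rank_sup_eq hZ.1 hZ.2 hXY).trans hY⟩
      (right_lt_sup.2 hZY)
  rw [hclosure, hY]

theorem IsQMatroid.rankClosure_isFlat (hr : IsQMatroid r) (X : Submodule K V) :
    IsFlat r (rankClosure r X) := by
  intro x _ hxX
  refine lt_of_le_of_ne (hr.2.1 _ _ le_sup_left) fun h => hxX ?_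
  exact le_sup_right.trans (le_rankClosure_of_rank_eq ((le_rankClosure r X).trans le_sup_left)
    (h.symm.trans (hr.rank_rankClosure X)))

theorem IsFlat.rankClosure_eq (hr : IsQMatroid r) {F : Submodule K V} (hF : IsFlat r F) :
    rankClosure r F = F :=
  le_antisymm (hF.le_of_rank_le hr (le_rankClosure r F) (hr.rank_rankClosure F).le)
    (le_rankClosure r F)

theorem IsQMatroid.rankClosure_mono (hr : IsQMatroid r) {X Y : Submodule K V} (h : X ≤ Y) :
    rankClosure r X ≤ rankClosure r Y :=
  le_sup_left.trans (le_rankClosure_of_rank_eq le_sup_right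
    (hr.rank_sup_eq (le_rankClosure r X) (hr.rank_rankClosure X) h))

theorem IsQMatroid.rankClosure_eq_of_le (hr : IsQMatroid r) {X Y : Submodule K V}
    (h : X ≤ Y) (hXY : r Y = r X) : rankClosure r X = rankClosure r Y :=
  le_antisymm (hr.rankClosure_mono h)
    (le_rankClosure_of_rank_eq (h.trans (le_rankClosure r Y))
      ((hr.rank_rankClosure Y).trans hXY))

theorem IsModularCut.rankClosure_mem_of_le (hr : IsQMatroid r) {M : Set (Submodule K V)}
    (hM : IsModularCut r M) {X Y : Submodule K V} (h : X ≤ Y) (hX : rankClosure r X ∈ M) :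
    rankClosure r Y ∈ M :=
  hM.2.1 _ hX _ (hr.rankClosure_isFlat Y) (hr.rankClosure_mono h)

theorem IsModularCut.rankClosure_inf_mem (hr : IsQMatroid r) {M : Set (Submodule K V)}
    (hM : IsModularCut r M) {X Y : Submodule K V} (hX : rankClosure r X ∈ M)
    (hY : rankClosure r Y ∈ M) (h : r X + r Y ≤ r (X ⊔ Y) + r (X ⊓ Y)) :
    rankClosure r (X ⊓ Y) ∈ M := by
  have h₁ := hr.rank_rankClosure X
  have h₂ := hr.rank_rankClosure Y
  have hle : X ⊓ Y ≤ rankClosure r X ⊓ rankClosure r Y :=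
    inf_le_inf (le_rankClosure r X) (le_rankClosure r Y)
  have h₃ := hr.2.1 _ _ hle
  have h₄ := hr.2.1 _ _ (sup_le_sup (le_rankClosure r X) (le_rankClosure r Y))
  have h₅ := hr.2.2 (rankClosure r X) (rankClosure r Y)
  have hmem := hM.2.2 _ hX _ hY (by unfold ModularPair; omega)
  have hflat := hM.1 _ hmem
  rw [hr.rankClosure_eq_of_le hle (by omega), hflat.rankClosure_eq hr]
  exact hmem

end RankFunction

section Hyperplane

variable [Field K] [AddCommGroup V] [Module K V] {W : Submodule K V}

theorem comap_subtype_map_subtype (A : Submodule K ↥W) :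
    comap W.subtype (map W.subtype A) = A :=
  comap_map_eq_of_injective W.injective_subtype A

theorem map_subtype_comap_subtype_of_le {X : Submodule K V} (h : X ≤ W) :
    map W.subtype (comap W.subtype X) = X := by
  rw [map_comap_subtype, inf_eq_right.2 h]

theorem exists_delta_le {X : Submodule K V} (h : ¬ X ≤ W) :
    ∃ e : Delta W, (e : Submodule K V) ≤ X := by
  obtain ⟨e, h₁, h₂, h₃⟩ := exists_oneDim_le_not_le h
  exact ⟨⟨e, h₁, h₃⟩, h₂⟩

theorem map_sup_delta_not_le (A : Submodule K ↥W) (e : Delta W) :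
    ¬ map W.subtype A ⊔ (e : Submodule K V) ≤ W :=
  fun h => e.2.2 (le_sup_right.trans h)

theorem rank_sup_delta_le {rN : Submodule K V → ℕ} (hN : IsQMatroid rN) (X : Submodule K V)
    (e : Delta W) : rN (X ⊔ e) ≤ rN X + 1 := by
  have h₁ := hN.2.2 X e
  have h₂ := hN.1 e
  have h₃ : finrank K (e : Submodule K V) = 1 := e.2.1
  omega

variable [FiniteDimensional K V]

theorem inf_delta_eq_bot (e : Delta W) : W ⊓ (e : Submodule K V) = ⊥ := by
  have hlt : W ⊓ (e : Submodule K V) < e :=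
    lt_of_le_of_ne inf_le_right fun h => e.2.2 (inf_eq_right.1 h)
  have h₁ := Submodule.finrank_lt_finrank_of_lt hlt
  have h₂ : finrank K (e : Submodule K V) = 1 := e.2.1
  exact Submodule.finrank_eq_zero.1 (by omega)

theorem comap_map_sup_delta (A : Submodule K ↥W) (e : Delta W) :
    comap W.subtype (map W.subtype A ⊔ (e : Submodule K V)) = A := by
  apply map_injective_of_injective W.injective_subtype
  rw [map_comap_subtype, inf_comm, sup_inf_assoc_of_le _ (map_subtype_le W A), inf_comm,
    inf_delta_eq_bot, sup_bot_eq]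

theorem sup_delta_eq_top (hdim : finrank K V = finrank K ↥W + 1) (e : Delta W) :
    W ⊔ (e : Submodule K V) = ⊤ := by
  have h₁ := Submodule.finrank_lt_finrank_of_lt (left_lt_sup.2 e.2.2)
  have h₂ := Submodule.finrank_le (W ⊔ (e : Submodule K V))
  exact Submodule.eq_top_of_finrank_eq (by omega)

theorem map_comap_sup_delta (hdim : finrank K V = finrank K ↥W + 1) (e : Delta W)
    {X : Submodule K V} (h : (e : Submodule K V) ≤ X) :
    map W.subtype (comap W.subtype X) ⊔ (e : Submodule K V) = X := by
  rw [map_comap_subtype, sup_comm, inf_comm W X, inf_comm X W, ← sup_inf_assoc_of_le W h,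
    sup_comm, sup_delta_eq_top hdim, top_inf_eq]

theorem finrank_comap_lt {X : Submodule K V} (h : ¬ X ≤ W) :
    finrank K (comap W.subtype X) < finrank K X := by
  rw [← finrank_map_subtype_eq]
  exact Submodule.finrank_lt_finrank_of_lt (lt_of_le_of_ne (map_comap_le _ _)
    fun heq => h (heq ▸ map_subtype_le W _))

theorem map_sup_delta_eq_of_le (hdim : finrank K V = finrank K ↥W + 1) (e₁ e₂ : Delta W)
    {F : Submodule K ↥W}
    (h : (e₂ : Submodule K V) ≤ map W.subtype F ⊔ (e₁ : Submodule K V)) :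
    map W.subtype F ⊔ (e₁ : Submodule K V) = map W.subtype F ⊔ (e₂ : Submodule K V) := by
  have := map_comap_sup_delta hdim e₂ h
  rwa [comap_map_sup_delta, eq_comm] at this

end Hyperplane

section Extension

variable [Field K] [AddCommGroup V] [Module K V] {W : Submodule K V}
  {r : Submodule K ↥W → ℕ} {μ : Delta W → Set (Submodule K ↥W)}

open Classical in
/-- The rank increment caused by adding `e` to `A`. -/
noncomputable def selectorDefect (r : Submodule K ↥W → ℕ) (μ : Delta W → Set (Submodule K ↥W))
    (e : Delta W) (A : Submodule K ↥W) : ℕ :=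
  if rankClosure r A ∈ μ e then 0 else 1

open Classical in
/-- The rank function on the ambient space determined by a modular cut selector. -/
noncomputable def selectorRank (r : Submodule K ↥W → ℕ) (μ : Delta W → Set (Submodule K ↥W))
    (X : Submodule K V) : ℕ :=
  r (comap W.subtype X) +
    if X ≤ W ∨ ∃ e : Delta W, (e : Submodule K V) ≤ X ∧
      rankClosure r (comap W.subtype X) ∈ μ e then 0 else 1

theorem selectorDefect_le_one (e : Delta W) (A : Submodule K ↥W) :
    selectorDefect r μ e A ≤ 1 := by
  unfold selectorDefect
  split_ifs <;> omega

theorem selectorDefect_eq_zero {e : Delta W} {A : Submodule K ↥W} :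
    selectorDefect r μ e A = 0 ↔ rankClosure r A ∈ μ e := by
  simp [selectorDefect]

theorem selectorRank_map (A : Submodule K ↥W) : selectorRank r μ (map W.subtype A) = r A := by
  simp [selectorRank, comap_subtype_map_subtype, map_subtype_le]

variable [FiniteDimensional K V]

theorem selectorDefect_anti (hr : IsQMatroid r) (hμ : IsMCS W r μ) (e : Delta W)
    {A B : Submodule K ↥W} (h : A ≤ B) : selectorDefect r μ e B ≤ selectorDefect r μ e A := by
  by_cases hA : rankClosure r A ∈ μ e
  · rw [selectorDefect_eq_zero.2 ((hμ.1 e).rankClosure_mem_of_le hr h hA)]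
    exact Nat.zero_le _
  · have h₁ := mt selectorDefect_eq_zero.1 hA
    have h₂ := selectorDefect_le_one (r := r) (μ := μ) e B
    omega

theorem rank_add_selectorDefect_mono (hr : IsQMatroid r) (e : Delta W)
    {A B : Submodule K ↥W} (h : A ≤ B) :
    r A + selectorDefect r μ e A ≤ r B + selectorDefect r μ e B := by
  have h₁ := hr.2.1 A B h
  have h₂ := selectorDefect_le_one (r := r) (μ := μ) e A
  by_cases hAB : r B = r A
  · unfold selectorDefect
    rw [hr.rankClosure_eq_of_le h hAB, hAB]
  · omega

theorem rank_add_selectorDefect_submodular (hr : IsQMatroid r) (hμ : IsMCS W r μ) (e : Delta W)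
    (A B : Submodule K ↥W) :
    (r (A ⊔ B) + selectorDefect r μ e (A ⊔ B)) + (r (A ⊓ B) + selectorDefect r μ e (A ⊓ B)) ≤
      (r A + selectorDefect r μ e A) + (r B + selectorDefect r μ e B) := by
  have h₁ := hr.2.2 A B
  have h₂ := selectorDefect_anti hr hμ e (le_sup_left : A ≤ A ⊔ B)
  have h₃ := selectorDefect_anti hr hμ e (le_sup_right : B ≤ A ⊔ B)
  have h₄ := selectorDefect_le_one (r := r) (μ := μ) e (A ⊓ B)
  have h₅ := selectorDefect_le_one (r := r) (μ := μ) e A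
  have h₆ := selectorDefect_le_one (r := r) (μ := μ) e B
  by_cases hA : selectorDefect r μ e A = 0
  · by_cases hB : selectorDefect r μ e B = 0
    · by_cases h : r A + r B ≤ r (A ⊔ B) + r (A ⊓ B)
      · have h₇ := selectorDefect_eq_zero.2 ((hμ.1 e).rankClosure_inf_mem hr
          (selectorDefect_eq_zero.1 hA) (selectorDefect_eq_zero.1 hB) h)
        omega
      · omega
    · omega
  · omega

variable (hdim : finrank K V = finrank K ↥W + 1)
include hdim

theorem selectorRank_map_sup (hμ : IsMCS W r μ) (A : Submodule K ↥W) (e : Delta W) :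
    selectorRank r μ (map W.subtype A ⊔ (e : Submodule K V)) = r A + selectorDefect r μ e A := by
  have hiff : (∃ e' : Delta W, (e' : Submodule K V) ≤ map W.subtype A ⊔ (e : Submodule K V) ∧
      rankClosure r A ∈ μ e') ↔ rankClosure r A ∈ μ e := by
    refine ⟨?_, fun h => ⟨e, le_sup_right, h⟩⟩
    rintro ⟨e', hle, hmem⟩
    refine (hμ.2 e' e _ hmem).1 (map_sup_delta_eq_of_le hdim e e' ?_).symm
    exact hle.trans (sup_le_sup_right (map_mono (le_rankClosure r A)) _)
  unfold selectorRank selectorDefect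
  rw [comap_map_sup_delta]
  congr 1
  classical
  exact if_congr ((or_iff_right (map_sup_delta_not_le A e)).trans hiff) rfl rfl

theorem selectorRank_eq_of_delta_le (hμ : IsMCS W r μ) {X : Submodule K V} {e : Delta W}
    (h : (e : Submodule K V) ≤ X) :
    selectorRank r μ X = r (comap W.subtype X) + selectorDefect r μ e (comap W.subtype X) := by
  rw [← selectorRank_map_sup hdim hμ, map_comap_sup_delta hdim e h]

theorem selectorRank_submodular_of_le (hr : IsQMatroid r) (hμ : IsMCS W r μ)
    {X : Submodule K V} (hX : X ≤ W) (Y : Submodule K V) :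
    selectorRank r μ (X ⊔ Y) + selectorRank r μ (X ⊓ Y) ≤
      selectorRank r μ X + selectorRank r μ Y := by
  obtain ⟨A, rfl⟩ : ∃ A : Submodule K ↥W, map W.subtype A = X :=
    ⟨_, map_subtype_comap_subtype_of_le hX⟩
  have hinf : selectorRank r μ (map W.subtype A ⊓ Y) = r (A ⊓ comap W.subtype Y) := by
    rw [← map_subtype_comap_subtype_of_le (inf_le_left.trans hX), selectorRank_map, comap_inf,
      comap_subtype_map_subtype]
  rw [hinf, selectorRank_map]
  by_cases hY : Y ≤ W
  · obtain ⟨B, rfl⟩ : ∃ B : Submodule K ↥W, map W.subtype B = Y :=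
      ⟨_, map_subtype_comap_subtype_of_le hY⟩
    rw [← Submodule.map_sup, selectorRank_map, selectorRank_map, comap_subtype_map_subtype]
    exact hr.2.2 A B
  · obtain ⟨e, he⟩ := exists_delta_le hY
    obtain ⟨B, rfl⟩ : ∃ B : Submodule K ↥W, map W.subtype B ⊔ (e : Submodule K V) = Y :=
      ⟨_, map_comap_sup_delta hdim e he⟩
    rw [← sup_assoc, ← Submodule.map_sup, selectorRank_map_sup hdim hμ,
      selectorRank_map_sup hdim hμ, comap_map_sup_delta]
    have h₁ := hr.2.2 A B
    have h₂ := selectorDefect_anti hr hμ e (le_sup_right : B ≤ A ⊔ B)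
    omega

theorem selectorRank_submodular_of_inf_le (hr : IsQMatroid r) (hμ : IsMCS W r μ)
    {X Y : Submodule K V} (hX : ¬ X ≤ W) (hY : ¬ Y ≤ W) (h : X ⊓ Y ≤ W) :
    selectorRank r μ (X ⊔ Y) + selectorRank r μ (X ⊓ Y) ≤
      selectorRank r μ X + selectorRank r μ Y := by
  obtain ⟨e₁, he₁⟩ := exists_delta_le hX
  obtain ⟨e₂, he₂⟩ := exists_delta_le hY
  have hinf : selectorRank r μ (X ⊓ Y) = r (comap W.subtype X ⊓ comap W.subtype Y) := by
    rw [← map_subtype_comap_subtype_of_le h, selectorRank_map, comap_inf]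
  rw [hinf, selectorRank_eq_of_delta_le hdim hμ he₁, selectorRank_eq_of_delta_le hdim hμ he₂]
  have hsup₁ := selectorRank_eq_of_delta_le hdim hμ (he₁.trans (le_sup_left : X ≤ X ⊔ Y))
  have hsup₂ := selectorRank_eq_of_delta_le hdim hμ (he₂.trans (le_sup_right : Y ≤ X ⊔ Y))
  have hXY : comap W.subtype (X ⊔ Y) =
      comap W.subtype X ⊔ comap W.subtype Y ⊔
        comap W.subtype ((e₁ : Submodule K V) ⊔ (e₂ : Submodule K V)) := by
    rw [← comap_map_sup_delta (comap W.subtype X ⊔ comap W.subtype Y ⊔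
      comap W.subtype ((e₁ : Submodule K V) ⊔ (e₂ : Submodule K V))) e₁]
    congr 1
    rw [Submodule.map_sup, sup_assoc, map_comap_sup_delta hdim e₁ le_sup_left,
      Submodule.map_sup, sup_sup_sup_comm, map_comap_sup_delta hdim e₁ he₁,
      map_comap_sup_delta hdim e₂ he₂]
  have hA := (comap_mono le_sup_left : comap W.subtype X ≤ comap W.subtype (X ⊔ Y))
  have hB := (comap_mono le_sup_right : comap W.subtype Y ≤ comap W.subtype (X ⊔ Y))
  have ha₁ := selectorDefect_anti hr hμ e₁ hA
  have ha₂ := selectorDefect_anti hr hμ e₂ hB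
  have hd : r (comap W.subtype (X ⊔ Y)) ≤ r (comap W.subtype X ⊔ comap W.subtype Y) + 1 := by
    have h₁ : finrank K (comap W.subtype ((e₁ : Submodule K V) ⊔ (e₂ : Submodule K V))) <
        finrank K ((e₁ : Submodule K V) ⊔ (e₂ : Submodule K V) : Submodule K V) :=
      finrank_comap_lt fun hle => e₁.2.2 (le_sup_left.trans hle)
    have h₂ := Submodule.finrank_add_le_finrank_add_finrank (e₁ : Submodule K V) e₂
    have h₃ : finrank K (e₁ : Submodule K V) = 1 := e₁.2.1
    have h₄ : finrank K (e₂ : Submodule K V) = 1 := e₂.2.1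
    have h₅ := hr.1 (comap W.subtype ((e₁ : Submodule K V) ⊔ (e₂ : Submodule K V)))
    have h₆ := hr.2.2 (comap W.subtype X ⊔ comap W.subtype Y)
      (comap W.subtype ((e₁ : Submodule K V) ⊔ (e₂ : Submodule K V)))
    rw [← hXY] at h₆
    omega
  have hs := hr.2.2 (comap W.subtype X) (comap W.subtype Y)
  have hl₁ := selectorDefect_le_one (r := r) (μ := μ) e₁ (comap W.subtype X)
  have hl₂ := selectorDefect_le_one (r := r) (μ := μ) e₂ (comap W.subtype Y)
  by_cases hboth : selectorDefect r μ e₁ (comap W.subtype X) = 0 ∧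
      selectorDefect r μ e₂ (comap W.subtype Y) = 0
  · have hG₁ := (hμ.1 e₁).rankClosure_mem_of_le hr
      (le_sup_left : _ ≤ comap W.subtype X ⊔ comap W.subtype Y)
      (selectorDefect_eq_zero.1 hboth.1)
    have hG₂ := (hμ.1 e₂).rankClosure_mem_of_le hr
      (le_sup_right : _ ≤ comap W.subtype X ⊔ comap W.subtype Y)
      (selectorDefect_eq_zero.1 hboth.2)
    have hG := (hμ.2 e₁ e₂ _ hG₁).2 hG₂
    have hGcl := le_rankClosure r (comap W.subtype X ⊔ comap W.subtype Y)
    generalize hGdef : rankClosure r (comap W.subtype X ⊔ comap W.subtype Y) = G at *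
    have hle : X ⊔ Y ≤ map W.subtype G ⊔ (e₁ : Submodule K V) := by
      apply sup_le
      · conv_lhs => rw [← map_comap_sup_delta hdim e₁ he₁]
        exact sup_le_sup_right (map_mono (le_sup_left.trans hGcl)) _
      · rw [hG]
        conv_lhs => rw [← map_comap_sup_delta hdim e₂ he₂]
        exact sup_le_sup_right (map_mono (le_sup_right.trans hGcl)) _
    have hle' := comap_mono (f := W.subtype) hle
    rw [comap_map_sup_delta] at hle'
    have h₁ := hr.2.1 _ _ hle'
    rw [← hGdef, hr.rank_rankClosure] at h₁
    omega
  · omega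

theorem selectorRank_isQMatroid (hr : IsQMatroid r) (hμ : IsMCS W r μ) :
    IsQMatroid (selectorRank r μ) := by
  refine ⟨fun X => ?_, fun X Y hXY => ?_, fun X Y => ?_⟩
  · by_cases hX : X ≤ W
    · rw [← map_subtype_comap_subtype_of_le hX, selectorRank_map,
        finrank_map_subtype_eq]
      exact hr.1 _
    · obtain ⟨e, he⟩ := exists_delta_le hX
      rw [selectorRank_eq_of_delta_le hdim hμ he]
      have h₁ := finrank_comap_lt hX
      have h₂ := hr.1 (comap W.subtype X)
      have h₃ := selectorDefect_le_one (r := r) (μ := μ) e (comap W.subtype X)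
      omega
  · have hle := comap_mono (f := W.subtype) hXY
    by_cases hX : X ≤ W
    · rw [← map_subtype_comap_subtype_of_le hX, selectorRank_map]
      exact (hr.2.1 _ _ hle).trans (Nat.le_add_right _ _)
    · obtain ⟨e, he⟩ := exists_delta_le hX
      rw [selectorRank_eq_of_delta_le hdim hμ he,
        selectorRank_eq_of_delta_le hdim hμ (he.trans hXY)]
      exact rank_add_selectorDefect_mono hr e hle
  · by_cases hX : X ≤ W
    · exact selectorRank_submodular_of_le hdim hr hμ hX Y
    by_cases hY : Y ≤ W
    · rw [sup_comm, inf_comm, add_comm (selectorRank r μ X)]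
      exact selectorRank_submodular_of_le hdim hr hμ hY X
    by_cases hXY : X ⊓ Y ≤ W
    · exact selectorRank_submodular_of_inf_le hdim hr hμ hX hY hXY
    obtain ⟨e, he⟩ := exists_delta_le hXY
    have heX := he.trans inf_le_left
    have heY := he.trans inf_le_right
    have hsup : X ⊔ Y = map W.subtype (comap W.subtype X ⊔ comap W.subtype Y) ⊔
        (e : Submodule K V) := by
      rw [Submodule.map_sup, sup_sup_distrib_right, map_comap_sup_delta hdim e heX,
        map_comap_sup_delta hdim e heY]
    rw [selectorRank_eq_of_delta_le hdim hμ he, selectorRank_eq_of_delta_le hdim hμ heX,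
      selectorRank_eq_of_delta_le hdim hμ heY, hsup, selectorRank_map_sup hdim hμ, comap_inf]
    exact rank_add_selectorDefect_submodular hr hμ e _ _

omit hdim

variable {rN : Submodule K V → ℕ}

theorem rank_map_rankClosure_sup_eq (hr : IsQMatroid r) (hN : IsQMatroid rN)
    (hext : ∀ X : Submodule K ↥W, rN (map W.subtype X) = r X) (A : Submodule K ↥W)
    (e : Submodule K V) :
    rN (map W.subtype (rankClosure r A) ⊔ e) = rN (map W.subtype A ⊔ e) := by
  have hle : map W.subtype A ≤ map W.subtype (rankClosure r A) := map_mono (le_rankClosure r A)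
  have h := hN.rank_sup_eq hle (by rw [hext, hext, hr.rank_rankClosure])
    (le_sup_left : _ ≤ map W.subtype A ⊔ e)
  rwa [← sup_assoc, sup_eq_left.2 hle] at h

include hdim in
theorem isFlat_map_sup_delta (hr : IsQMatroid r) (hN : IsQMatroid rN)
    (hext : ∀ X : Submodule K ↥W, rN (map W.subtype X) = r X) {F : Submodule K ↥W}
    (hF : IsFlat r F) (e : Delta W)
    (h : rN (map W.subtype F ⊔ (e : Submodule K V)) = rN (map W.subtype F)) :
    IsFlat rN (map W.subtype F ⊔ (e : Submodule K V)) := by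
  intro x _ hxF
  refine lt_of_le_of_ne (hN.2.1 _ _ le_sup_left) fun heq => hxF ?_
  set X := map W.subtype F ⊔ (e : Submodule K V) ⊔ x with hX
  have heX : (e : Submodule K V) ≤ X := le_sup_right.trans le_sup_left
  have hFX : F ≤ comap W.subtype X := map_le_iff_le_comap.1 (le_sup_left.trans le_sup_left)
  have hle : comap W.subtype X ≤ F := by
    apply hF.le_of_rank_le hr hFX
    rw [← hext, ← hext, ← h, heq]
    exact hN.2.1 _ _ (map_comap_le _ _)
  rw [← map_comap_sup_delta hdim e heX] at hX
  exact (le_sup_right.trans hX.ge).trans (sup_le_sup_right (map_mono hle) _)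

end Extension

/-- the map assigning to each one-dimensional extension `N` of the
q-matroid `rM` on `W` the function `μ_N` is a bijection from the set of
one-dimensional extensions of `rM` to `V` onto the set of modular cut
selectors of `rM`. -/
theorem stmt1 [Field K] [Fintype K] [AddCommGroup V] [Module K V] [FiniteDimensional K V]
    (W : Submodule K V) (hdim : Module.finrank K V = Module.finrank K ↥W + 1)
    (rM : Submodule K ↥W → ℕ) (hM : IsQMatroid rM)
    (f : {rN : Submodule K V → ℕ // IsQMatroid rN ∧
        ∀ X : Submodule K ↥W, rN (Submodule.map W.subtype X) = rM X} →
      (Delta W → Set (Submodule K ↥W)))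
    (hf : ∀ N, ∀ e : Delta W,
      f N e = {F : Submodule K ↥W | IsFlat rM F ∧
        IsFlat N.1 (Submodule.map W.subtype F ⊔ (e : Submodule K V)) ∧
        N.1 (Submodule.map W.subtype F ⊔ (e : Submodule K V)) =
          N.1 (Submodule.map W.subtype F)}) :
    Function.Injective f ∧
    Set.range f = {μ : Delta W → Set (Submodule K ↥W) | IsMCS W rM μ} := by
  have hmem : ∀ N, ∀ e : Delta W, ∀ F, F ∈ f N e ↔
      IsFlat rM F ∧ N.1 (map W.subtype F ⊔ (e : Submodule K V)) = rM F := by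
    intro N e F
    rw [hf, Set.mem_ofPred_eq, ← N.2.2 F]
    exact ⟨fun h => ⟨h.1, h.2.2⟩,
      fun h => ⟨h.1, isFlat_map_sup_delta hdim hM N.2.1 N.2.2 h.1 e h.2, h.2⟩⟩
  refine ⟨fun N₁ N₂ h => Subtype.ext (funext fun X => ?_), Set.Subset.antisymm ?_ fun μ hμ => ?_⟩
  · by_cases hX : X ≤ W
    · rw [← map_subtype_comap_subtype_of_le hX, N₁.2.2, N₂.2.2]
    obtain ⟨e, he⟩ := exists_delta_le hX
    obtain ⟨A, rfl⟩ : ∃ A : Submodule K ↥W, map W.subtype A ⊔ (e : Submodule K V) = X :=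
      ⟨_, map_comap_sup_delta hdim e he⟩
    have hiff : ∀ N, rankClosure rM A ∈ f N e ↔
        N.1 (map W.subtype A ⊔ (e : Submodule K V)) = rM A := by
      intro N
      rw [hmem, rank_map_rankClosure_sup_eq hM N.2.1 N.2.2, hM.rank_rankClosure]
      exact and_iff_right (hM.rankClosure_isFlat A)
    have h₀ := (hiff N₁).symm.trans ((Set.ext_iff.1 (congrFun h e) _).trans (hiff N₂))
    have bounds : ∀ N : {rN : Submodule K V → ℕ // IsQMatroid rN ∧
        ∀ X : Submodule K ↥W, rN (map W.subtype X) = rM X},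
        rM A ≤ N.1 (map W.subtype A ⊔ (e : Submodule K V)) ∧
          N.1 (map W.subtype A ⊔ (e : Submodule K V)) ≤ rM A + 1 := by
      intro N
      rw [← N.2.2 A]
      exact ⟨N.2.1.2.1 _ _ le_sup_left, rank_sup_delta_le N.2.1 _ e⟩
    have h₁ := bounds N₁
    have h₂ := bounds N₂
    omega
  · rintro _ ⟨N, rfl⟩
    have hN := N.2.1
    have hext := N.2.2
    refine ⟨fun e => ⟨fun F hF => ((hmem N e F).1 hF).1, fun F hF F' hF' hle => ?_,
      fun F₁ hF₁ F₂ hF₂ hmod => ?_⟩, fun e₁ e₂ F hF => ?_⟩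
    · rw [hmem] at hF ⊢
      refine ⟨hF', ?_⟩
      have h := hN.rank_sup_eq (le_sup_left : _ ≤ map W.subtype F ⊔ (e : Submodule K V))
        (hF.2.trans (hext F).symm) (map_mono hle : _ ≤ map W.subtype F')
      rwa [sup_right_comm, ← Submodule.map_sup, sup_eq_right.2 hle, hext] at h
    · rw [hmem] at hF₁ hF₂ ⊢
      refine ⟨hF₁.1.inf hM hF₂.1, ?_⟩
      unfold ModularPair at hmod
      have h₁ := hN.2.2 (map W.subtype F₁ ⊔ (e : Submodule K V)) (map W.subtype F₂ ⊔ e)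
      have h₂ := hN.2.1 (map W.subtype (F₁ ⊔ F₂))
        (map W.subtype F₁ ⊔ (e : Submodule K V) ⊔ (map W.subtype F₂ ⊔ e)) (by
          rw [Submodule.map_sup]
          exact sup_le_sup le_sup_left le_sup_left)
      have h₃ := hN.2.1 (map W.subtype (F₁ ⊓ F₂) ⊔ (e : Submodule K V))
        ((map W.subtype F₁ ⊔ (e : Submodule K V)) ⊓ (map W.subtype F₂ ⊔ e))
        (le_inf (sup_le_sup_right (map_mono inf_le_left) _)
          (sup_le_sup_right (map_mono inf_le_right) _))
      have h₄ := hN.2.1 (map W.subtype (F₁ ⊓ F₂)) (map W.subtype (F₁ ⊓ F₂) ⊔ e) le_sup_left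
      rw [hext] at h₂ h₄
      omega
    · constructor
      · intro h
        rw [hmem] at hF ⊢
        exact ⟨hF.1, h ▸ hF.2⟩
      · intro hF₂
        have hF₁ := hF
        rw [hmem] at hF₁ hF₂
        apply map_sup_delta_eq_of_le hdim
        have hflat := isFlat_map_sup_delta hdim hM hN hext hF₁.1 e₁ (hF₁.2.trans (hext F).symm)
        have h := hN.rank_sup_eq (le_sup_left : _ ≤ map W.subtype F ⊔ (e₂ : Submodule K V))
          (hF₂.2.trans (hext F).symm)
          (le_sup_left : _ ≤ map W.subtype F ⊔ (e₁ : Submodule K V))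
        exact (le_sup_right.trans le_sup_left).trans
          (hflat.le_of_rank_le hN le_sup_right h.le)
  · refine ⟨⟨selectorRank rM μ, selectorRank_isQMatroid hdim hM hμ, selectorRank_map⟩, ?_⟩
    funext e
    ext F
    rw [hmem]
    change _ ∧ selectorRank rM μ _ = _ ↔ _
    rw [selectorRank_map_sup hdim hμ, add_eq_left, selectorDefect_eq_zero]
    constructor
    · rintro ⟨hF, h⟩
      rwa [hF.rankClosure_eq hM] at h
    · intro h
      have hF := (hμ.1 e).1 F h
      exact ⟨hF, by rwa [hF.rankClosure_eq hM]⟩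
end

section
/- There exist exactly 10 isomorphism classes of q-matroids of rank 2 on a 4-dimensional vector space over F_2; that is, the set of functions r on the lattice of subspaces of F_2^4 satisfying the q-matroid axioms with r(F_2^4) = 2, considered up to the equivalence r ~ r∘ĝ for F_2-linear automorphisms g of F_2^4, has exactly 10 equivalence classes. -/
open Module Submodule

variable {K V V₁ V₂ : Type*}

section Parallelism

variable {E : Type*} [AddCommGroup E] [Module (ZMod 2) E]

theorem zmod_two_cases (c : ZMod 2) : c = 0 ∨ c = 1 := by
  revert c; decide

/-- The relation on vectors obtained from a rank function of rank two by
declaring two vectors parallel when they span a subspace of rank at most one. -/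
structure IsParallelism (R : E → E → Prop) : Prop where
  refl : ∀ v, R v v
  symm : ∀ {v w}, R v w → R w v
  add : ∀ {v w w'}, R v w → R v w' → R v (w + w')
  trans : ∀ {u v w}, R u v → R v w → (∀ x, R v x) ∨ R u w
  nontriv : ∃ u v, ¬ R u v

namespace IsParallelism

variable {R : E → E → Prop} (h : IsParallelism R)
include h

theorem zero_right (v : E) : R v 0 := by
  have := h.add (h.refl v) (h.refl v)
  rwa [ZModModule.add_self] at this

theorem smul (c : ZMod 2) {v w : E} (hw : R v w) : R v (c • w) := by
  rcases zmod_two_cases c with rfl | rfl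
  · simpa using h.zero_right v
  · simpa using hw

omit h in
/-- The vectors parallel to `v`. -/
def block (h : IsParallelism R) (v : E) : Submodule (ZMod 2) E where
  carrier := {w | R v w}
  add_mem' := h.add
  zero_mem' := h.zero_right v
  smul_mem' c _ hw := h.smul c hw

omit h in
/-- The vectors parallel to every vector. -/
def loops (h : IsParallelism R) : Submodule (ZMod 2) E where
  carrier := {v | ∀ w, R v w}
  add_mem' hv hv' w := h.symm (h.add (h.symm (hv w)) (h.symm (hv' w)))
  zero_mem' w := h.symm (h.zero_right w)
  smul_mem' c _ hv w := h.symm (h.smul c (h.symm (hv w)))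

theorem rel_of_add_loop {v w : E} (hvw : ∀ x, R (v + w) x) : R v w := by
  have := h.add (h.refl v) (h.symm (hvw v))
  rwa [← add_assoc, ZModModule.add_self, zero_add] at this

omit [Module (ZMod 2) E] in
theorem trans_of_not_loop {u v w : E} (hv : ¬ ∀ x, R v x) (huv : R v u) (hvw : R v w) :
    R u w :=
  (h.trans (h.symm huv) hvw).resolve_left hv

theorem rel_of_mem_span_pair {v w x y : E} (hvw : R v w)
    (hx : x ∈ span (ZMod 2) {v, w}) (hy : y ∈ span (ZMod 2) {v, w}) : R x y := by
  have hv : span (ZMod 2) {v, w} ≤ h.block v := by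
    rw [span_le]
    rintro z (rfl | rfl)
    exacts [h.refl _, hvw]
  have hw : span (ZMod 2) {v, w} ≤ h.block w := by
    rw [span_le]
    rintro z (rfl | rfl)
    exacts [h.symm hvw, h.refl _]
  by_cases lv : ∀ z, R v z
  · by_cases lw : ∀ z, R w z
    · have : span (ZMod 2) {v, w} ≤ h.loops := by
        rw [span_le]
        rintro z (rfl | rfl)
        exacts [lv, lw]
      exact this hx y
    · exact h.trans_of_not_loop lw (hw hx) (hw hy)
  · exact h.trans_of_not_loop lv (hv hx) (hv hy)

end IsParallelism

open Classical in
/-- The rank function of rank two whose parallel vectors are given by `R`. -/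
noncomputable def parallelRank (R : E → E → Prop) (X : Submodule (ZMod 2) E) : ℕ :=
  if ∀ v ∈ X, ∀ w, R v w then 0 else if ∀ v ∈ X, ∀ w ∈ X, R v w then 1 else 2

theorem parallelRank_le_zero {R : E → E → Prop} {X : Submodule (ZMod 2) E} :
    parallelRank R X ≤ 0 ↔ ∀ v ∈ X, ∀ w, R v w := by
  unfold parallelRank
  split_ifs <;> simp_all

theorem parallelRank_le_one {R : E → E → Prop} {X : Submodule (ZMod 2) E} :
    parallelRank R X ≤ 1 ↔ ∀ v ∈ X, ∀ w ∈ X, R v w := by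
  unfold parallelRank
  split_ifs <;> simp_all

theorem parallelRank_le_two (R : E → E → Prop) (X : Submodule (ZMod 2) E) :
    parallelRank R X ≤ 2 := by
  unfold parallelRank
  split_ifs <;> simp

/-- Two vectors span a subspace of rank at most one. -/
def Parallel (r : Submodule (ZMod 2) E → ℕ) (v w : E) : Prop := r (span (ZMod 2) {v, w}) ≤ 1

namespace IsParallelism

variable {R : E → E → Prop} (h : IsParallelism R)
include h

theorem parallel_parallelRank (v w : E) : Parallel (parallelRank R) v w ↔ R v w := by
  unfold Parallel
  rw [parallelRank_le_one]
  exact ⟨fun H => H v (mem_span_of_mem (by simp)) w (mem_span_of_mem (by simp)),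
    fun H x hx y hy => h.rel_of_mem_span_pair H hx hy⟩

theorem parallelRank_top : parallelRank R ⊤ = 2 := by
  have h1 := parallelRank_le_two R ⊤
  have h2 : ¬ parallelRank R ⊤ ≤ 1 := by
    rw [parallelRank_le_one]
    obtain ⟨u, v, huv⟩ := h.nontriv
    exact fun H => huv (H u mem_top v mem_top)
  omega

theorem isQMatroid [Module.Finite (ZMod 2) E] : IsQMatroid (parallelRank R) := by
  have mono : ∀ X Y : Submodule (ZMod 2) E, X ≤ Y → parallelRank R X ≤ parallelRank R Y := by
    intro X Y hXY
    have h0 : parallelRank R Y ≤ 0 → parallelRank R X ≤ 0 := by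
      simp only [parallelRank_le_zero]
      exact fun H v hv => H v (hXY hv)
    have h1 : parallelRank R Y ≤ 1 → parallelRank R X ≤ 1 := by
      simp only [parallelRank_le_one]
      exact fun H v hv w hw => H v (hXY hv) w (hXY hw)
    have h2 := parallelRank_le_two R X
    omega
  refine ⟨fun X => ?_, mono, fun X Y => ?_⟩
  · have h0 : finrank (ZMod 2) X ≤ 0 → parallelRank R X ≤ 0 := by
      intro H
      rw [Nat.le_zero, finrank_eq_zero] at H
      rw [parallelRank_le_zero]
      rintro v hv w
      rw [H, mem_bot] at hv
      rw [hv]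
      exact h.symm (h.zero_right w)
    have h1 : finrank (ZMod 2) X ≤ 1 → parallelRank R X ≤ 1 := by
      intro H
      obtain ⟨u, hu⟩ := finrank_le_one_iff.1 H
      rw [parallelRank_le_one]
      intro v hv w hw
      obtain ⟨c, hc⟩ := hu ⟨v, hv⟩
      obtain ⟨d, hd⟩ := hu ⟨w, hw⟩
      have hc' : v = c • (u : E) := (congrArg Subtype.val hc).symm
      have hd' : w = d • (u : E) := (congrArg Subtype.val hd).symm
      rw [hc', hd']
      exact h.smul _ (h.symm (h.smul _ (h.refl _)))
    have h2 := parallelRank_le_two R X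
    omega
  · have hX := mono _ _ (inf_le_left : X ⊓ Y ≤ X)
    have hY := mono _ _ (inf_le_right : X ⊓ Y ≤ Y)
    have hS := parallelRank_le_two R (X ⊔ Y)
    have h2 := parallelRank_le_two R X
    have h2' := parallelRank_le_two R Y
    have join : ∀ u, ¬ (∀ x, R u x) → X ≤ h.block u → Y ≤ h.block u →
        parallelRank R (X ⊔ Y) ≤ 1 := by
      intro u hu hXu hYu
      rw [parallelRank_le_one]
      intro v hv w hw
      exact h.trans_of_not_loop hu (sup_le hXu hYu hv) (sup_le hXu hYu hw)
    have block_le : ∀ (Z : Submodule (ZMod 2) E) (u : E), u ∈ Z → parallelRank R Z ≤ 1 →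
        Z ≤ h.block u := fun Z u hu H w hw => parallelRank_le_one.1 H u hu w hw
    have loops_le : ∀ (Z : Submodule (ZMod 2) E) (u : E), parallelRank R Z ≤ 0 →
        Z ≤ h.block u := fun Z u H w hw => h.symm (parallelRank_le_zero.1 H w hw u)
    have exists_of : ∀ Z : Submodule (ZMod 2) E, ¬ parallelRank R Z ≤ 0 →
        ∃ u ∈ Z, ¬ ∀ x, R u x := by
      intro Z hZ
      rw [parallelRank_le_zero] at hZ
      push Not at hZ
      obtain ⟨u, hu, x, hx⟩ := hZ
      exact ⟨u, hu, fun H => hx (H x)⟩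
    by_cases hX0 : parallelRank R X ≤ 0
    · by_cases hY0 : parallelRank R Y ≤ 0
      · have : parallelRank R (X ⊔ Y) ≤ 0 := by
          rw [parallelRank_le_zero] at hX0 hY0 ⊢
          exact fun v hv => (sup_le hX0 hY0 : X ⊔ Y ≤ h.loops) hv
        omega
      · by_cases hY1 : parallelRank R Y ≤ 1
        · obtain ⟨u, hu, hu'⟩ := exists_of Y hY0
          have := join u hu' (loops_le X u hX0) (block_le Y u hu hY1)
          omega
        · omega
    · by_cases hX1 : parallelRank R X ≤ 1
      · by_cases hY0 : parallelRank R Y ≤ 0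
        · obtain ⟨u, hu, hu'⟩ := exists_of X hX0
          have := join u hu' (block_le X u hu hX1) (loops_le Y u hY0)
          omega
        · by_cases hI : parallelRank R (X ⊓ Y) ≤ 0
          · omega
          · by_cases hY1 : parallelRank R Y ≤ 1
            · obtain ⟨u, hu, hu'⟩ := exists_of _ hI
              have := join u hu' (block_le X u hu.1 hX1) (block_le Y u hu.2 hY1)
              omega
            · omega
      · omega

end IsParallelism

namespace IsQMatroid

variable {r : Submodule (ZMod 2) E → ℕ} (hr : IsQMatroid r)
include hr

theorem rank_span_singleton_le (v : E) : r (span (ZMod 2) {v}) ≤ 1 :=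
  (hr.1 _).trans (by simpa using finrank_span_le_card (R := ZMod 2) ({v} : Set E))

theorem rank_bot : r ⊥ = 0 := by
  have := hr.1 ⊥
  simpa using this

theorem rank_span_insert_le (v : E) (s : Finset E)
    (hs : ∀ w ∈ s, r (span (ZMod 2) {v, w}) ≤ r (span (ZMod 2) {v})) :
    r (span (ZMod 2) (insert v (s : Set E))) ≤ r (span (ZMod 2) {v}) := by
  classical
  induction s using Finset.induction_on with
  | empty => simp
  | insert w s _ ih =>
    have h1 := ih fun x hx => hs x (Finset.mem_insert_of_mem hx)
    have h2 := hs w (Finset.mem_insert_self w s)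
    have h3 := hr.2.2 (span (ZMod 2) (insert v (s : Set E))) (span (ZMod 2) {v, w})
    have h4 := hr.2.1 (span (ZMod 2) {v})
      (span (ZMod 2) (insert v (s : Set E)) ⊓ span (ZMod 2) {v, w})
      (le_inf (span_mono (by simp)) (span_mono (by simp)))
    have h5 : span (ZMod 2) (insert v ((insert w s : Finset E) : Set E)) =
        span (ZMod 2) (insert v (s : Set E)) ⊔ span (ZMod 2) {v, w} := by
      rw [← span_union]
      congr 1
      ext x
      simp
      tauto
    rw [h5]
    omega

theorem parallel_of_rank_zero {v : E} (hv : r (span (ZMod 2) {v}) = 0) (w : E) :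
    Parallel r v w := by
  have h1 := hr.2.2 (span (ZMod 2) {v}) (span (ZMod 2) {w})
  have h2 := hr.rank_span_singleton_le w
  unfold Parallel
  rw [span_insert]
  omega

theorem rank_span_triple_le {u v w : E} (hv : r (span (ZMod 2) {v}) ≠ 0)
    (hu : Parallel r v u) (hw : Parallel r v w) : r (span (ZMod 2) {v, u, w}) ≤ 1 := by
  classical
  have h1 := hr.rank_span_singleton_le v
  have h2 := hr.rank_span_insert_le v {u, w} (by
    intro x hx
    simp only [Finset.mem_insert, Finset.mem_singleton] at hx
    unfold Parallel at hu hw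
    rcases hx with rfl | rfl <;> omega)
  simp only [Finset.coe_insert, Finset.coe_singleton] at h2
  omega

theorem rank_le_of_forall_mem [Module.Finite (ZMod 2) E] (v : E) (X : Submodule (ZMod 2) E)
    (hX : ∀ w ∈ X, r (span (ZMod 2) {v, w}) ≤ r (span (ZMod 2) {v})) :
    r X ≤ r (span (ZMod 2) {v}) := by
  obtain ⟨s, rfl⟩ := (IsNoetherian.noetherian X : X.FG)
  exact (hr.2.1 _ _ (span_mono (Set.subset_insert _ _))).trans
    (hr.rank_span_insert_le v s fun w hw => hX w (mem_span_of_mem hw))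

theorem rank_le_zero_of_forall_mem [Module.Finite (ZMod 2) E] (X : Submodule (ZMod 2) E)
    (hX : ∀ w ∈ X, r (span (ZMod 2) {w}) = 0) : r X ≤ 0 := by
  have := hr.rank_le_of_forall_mem 0 X (by
    intro w hw
    rw [span_insert_zero, hX w hw]
    exact Nat.zero_le _)
  rwa [span_zero_singleton, hr.rank_bot] at this

theorem rank_le_one_iff [Module.Finite (ZMod 2) E] (X : Submodule (ZMod 2) E) :
    r X ≤ 1 ↔ ∀ v ∈ X, ∀ w ∈ X, Parallel r v w := by
  constructor
  · intro H v hv w hw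
    refine (hr.2.1 _ X ?_).trans H
    rw [span_le]
    rintro z (rfl | rfl)
    exacts [hv, hw]
  · intro H
    by_cases h0 : ∀ w ∈ X, r (span (ZMod 2) {w}) = 0
    · exact (hr.rank_le_zero_of_forall_mem X h0).trans zero_le_one
    · push Not at h0
      obtain ⟨v, hv, hv0⟩ := h0
      have h1 := hr.rank_span_singleton_le v
      have h2 : r (span (ZMod 2) {v}) = 1 := by omega
      have := hr.rank_le_of_forall_mem v X fun w hw => by
        rw [h2]
        exact H v hv w hw
      omega

theorem rank_le_zero_iff [Module.Finite (ZMod 2) E] (htop : r ⊤ = 2)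
    (X : Submodule (ZMod 2) E) : r X ≤ 0 ↔ ∀ v ∈ X, ∀ w, Parallel r v w := by
  constructor
  · intro H v hv w
    refine hr.parallel_of_rank_zero (Nat.le_zero.1 ((hr.2.1 _ X ?_).trans H)) w
    rwa [span_singleton_le_iff_mem]
  · intro H
    refine hr.rank_le_zero_of_forall_mem X fun v hv => ?_
    by_contra h0
    have h1 := hr.rank_span_singleton_le v
    have h2 : r (span (ZMod 2) {v}) = 1 := by omega
    have := hr.rank_le_of_forall_mem v ⊤ fun w _ => by
      rw [h2]
      exact H v hv w
    omega

theorem isParallelism [Module.Finite (ZMod 2) E] (htop : r ⊤ = 2) :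
    IsParallelism (Parallel r) where
  refl v := by
    unfold Parallel
    rw [Set.pair_eq_singleton]
    exact hr.rank_span_singleton_le v
  symm {v w} H := by
    unfold Parallel at H ⊢
    rwa [Set.pair_comm]
  add {v w w'} H H' := by
    by_cases h0 : r (span (ZMod 2) {v}) = 0
    · exact hr.parallel_of_rank_zero h0 _
    · refine (hr.2.1 _ _ ?_).trans (hr.rank_span_triple_le h0 H H')
      rw [span_le]
      rintro z (rfl | rfl)
      · exact mem_span_of_mem (by simp)
      · exact add_mem (mem_span_of_mem (by simp)) (mem_span_of_mem (by simp))
  trans {u v w} H H' := by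
    by_cases h0 : r (span (ZMod 2) {v}) = 0
    · exact Or.inl (hr.parallel_of_rank_zero h0)
    · right
      unfold Parallel at H
      rw [Set.pair_comm] at H
      refine (hr.2.1 _ _ (span_mono ?_)).trans (hr.rank_span_triple_le h0 H H')
      simp
  nontriv := by
    by_contra! H
    have := (hr.rank_le_one_iff ⊤).2 fun v _ w _ => H v w
    omega

theorem rank_eq_map_of_parallel_iff [Module.Finite (ZMod 2) E]
    {r' : Submodule (ZMod 2) E → ℕ} (hr' : IsQMatroid r') (htop : r ⊤ = 2) (htop' : r' ⊤ = 2)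
    (g : E ≃ₗ[ZMod 2] E) (hg : ∀ v w, Parallel r v w ↔ Parallel r' (g v) (g w))
    (X : Submodule (ZMod 2) E) : r X = r' (X.map g.toLinearMap) := by
  have h0 : r X ≤ 0 ↔ r' (X.map g.toLinearMap) ≤ 0 := by
    rw [hr.rank_le_zero_iff htop, hr'.rank_le_zero_iff htop']
    constructor
    · rintro H _ ⟨v, hv, rfl⟩ w
      have := (hg v (g.symm w)).1 (H v hv _)
      simpa using this
    · exact fun H v hv w => (hg v w).2 (H _ ⟨v, hv, rfl⟩ _)
  have h1 : r X ≤ 1 ↔ r' (X.map g.toLinearMap) ≤ 1 := by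
    rw [hr.rank_le_one_iff, hr'.rank_le_one_iff]
    constructor
    · rintro H _ ⟨v, hv, rfl⟩ _ ⟨w, hw, rfl⟩
      exact (hg v w).1 (H v hv w hw)
    · exact fun H v hv w hw => (hg v w).2 (H _ ⟨v, hv, rfl⟩ _ ⟨w, hw, rfl⟩)
  have h2 := hr.2.1 X ⊤ le_top
  have h3 := hr'.2.1 (X.map g.toLinearMap) ⊤ le_top
  omega

end IsQMatroid

theorem parallel_iff_of_rank_eq_map {r r' : Submodule (ZMod 2) E → ℕ} (g : E ≃ₗ[ZMod 2] E)
    (hg : ∀ X, r X = r' (X.map g.toLinearMap)) (v w : E) :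
    Parallel r v w ↔ Parallel r' (g v) (g w) := by
  unfold Parallel
  rw [hg, map_span, Set.image_pair]
  rfl

end Parallelism

section Frames

/-- The linear combination of four vectors with coefficients `s`. -/
def comb {E : Type*} [AddCommGroup E] [Module (ZMod 2) E] (a b c d : E)
    (s : Fin 4 → ZMod 2) : E :=
  s 0 • a + s 1 • b + s 2 • c + s 3 • d

/-- The standard basis vectors. -/
abbrev unitVec (i : Fin 4) : Fin 4 → ZMod 2 := Pi.single i 1

theorem comb_unitVec (a b c d : Fin 4 → ZMod 2) :
    comb a b c d (unitVec 0) = a ∧ comb a b c d (unitVec 1) = b ∧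
      comb a b c d (unitVec 2) = c ∧ comb a b c d (unitVec 3) = d := by
  simp [comb]

theorem comb_unitVec_self (s : Fin 4 → ZMod 2) :
    comb (unitVec 0) (unitVec 1) (unitVec 2) (unitVec 3) s = s := by
  ext i
  fin_cases i <;> simp [comb]

theorem eq_top_of_unitVec_mem {S : Submodule (ZMod 2) (Fin 4 → ZMod 2)}
    (h0 : unitVec 0 ∈ S) (h1 : unitVec 1 ∈ S) (h2 : unitVec 2 ∈ S) (h3 : unitVec 3 ∈ S) :
    S = ⊤ := by
  refine eq_top_iff.2 fun s _ => ?_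
  rw [← comb_unitVec_self s]
  exact add_mem (add_mem (add_mem (S.smul_mem _ h0) (S.smul_mem _ h1)) (S.smul_mem _ h2))
    (S.smul_mem _ h3)

theorem exists_equiv_of_comb {a b c d : Fin 4 → ZMod 2}
    (h : ∀ s, comb a b c d s = 0 → s = 0) :
    ∃ g : (Fin 4 → ZMod 2) ≃ₗ[ZMod 2] (Fin 4 → ZMod 2),
      g (unitVec 0) = a ∧ g (unitVec 1) = b ∧ g (unitVec 2) = c ∧ g (unitVec 3) = d := by
  let f := Fintype.linearCombination (ZMod 2) ![a, b, c, d]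
  have hf : ∀ s, f s = comb a b c d s := by
    intro s
    simp [f, Fintype.linearCombination_apply, Fin.sum_univ_four, comb]
  have hinj : Function.Injective f := by
    rw [injective_iff_map_eq_zero]
    exact fun s hs => h s (by rw [← hf, hs])
  refine ⟨LinearEquiv.ofInjectiveEndo f hinj, ?_⟩
  simp only [LinearEquiv.coe_ofInjectiveEndo, hf]
  exact comb_unitVec a b c d

theorem exists_notMem_span (s : Finset (Fin 4 → ZMod 2)) (hs : s.card < 4) :
    ∃ d, d ∉ span (ZMod 2) (s : Set (Fin 4 → ZMod 2)) := by
  by_contra! H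
  have h1 := eq_top_iff'.2 H
  have h2 := finrank_span_finset_le_card (R := ZMod 2) s
  unfold Set.finrank at h2
  rw [h1, finrank_top, finrank_fin_fun] at h2
  omega

theorem exists_equiv_of_notMem_span {a b c d : Fin 4 → ZMod 2} (ha : a ≠ 0)
    (hb : b ∉ span (ZMod 2) {a}) (hc : c ∉ span (ZMod 2) {a, b})
    (hd : d ∉ span (ZMod 2) {a, b, c}) :
    ∃ g : (Fin 4 → ZMod 2) ≃ₗ[ZMod 2] (Fin 4 → ZMod 2),
      g (unitVec 0) = a ∧ g (unitVec 1) = b ∧ g (unitVec 2) = c ∧ g (unitVec 3) = d := by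
  refine exists_equiv_of_comb fun s hs => ?_
  unfold comb at hs
  have h3 : s 3 = 0 := by
    refine (zmod_two_cases _).resolve_right fun h => hd ?_
    rw [h, one_smul] at hs
    rw [← neg_mem_iff, ← eq_neg_of_add_eq_zero_left hs]
    refine add_mem (add_mem ?_ ?_) ?_ <;> exact smul_mem _ _ (mem_span_of_mem (by simp))
  rw [h3, zero_smul, add_zero] at hs
  have h2 : s 2 = 0 := by
    refine (zmod_two_cases _).resolve_right fun h => hc ?_
    rw [h, one_smul] at hs
    rw [← neg_mem_iff, ← eq_neg_of_add_eq_zero_left hs]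
    refine add_mem ?_ ?_ <;> exact smul_mem _ _ (mem_span_of_mem (by simp))
  rw [h2, zero_smul, add_zero] at hs
  have h1 : s 1 = 0 := by
    refine (zmod_two_cases _).resolve_right fun h => hb ?_
    rw [h, one_smul] at hs
    rw [← neg_mem_iff, ← eq_neg_of_add_eq_zero_left hs]
    exact smul_mem _ _ (mem_span_of_mem (by simp))
  rw [h1, zero_smul, add_zero] at hs
  have h0 : s 0 = 0 := (smul_eq_zero.1 hs).resolve_right ha
  ext i
  fin_cases i <;> simp [h0, h1, h2, h3]

theorem mem_span_singleton_zmod_two {a b : Fin 4 → ZMod 2} :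
    b ∈ span (ZMod 2) {a} ↔ b = 0 ∨ b = a := by
  rw [mem_span_singleton]
  constructor
  · rintro ⟨s, rfl⟩
    rcases zmod_two_cases s with rfl | rfl <;> simp
  · rintro (rfl | rfl)
    exacts [⟨0, by simp⟩, ⟨1, by simp⟩]

theorem mem_span_pair_zmod_two {a b c : Fin 4 → ZMod 2} :
    c ∈ span (ZMod 2) {a, b} ↔ c = 0 ∨ c = a ∨ c = b ∨ c = a + b := by
  rw [mem_span_pair]
  constructor
  · rintro ⟨s, t, rfl⟩
    rcases zmod_two_cases s with rfl | rfl <;> rcases zmod_two_cases t with rfl | rfl <;> simp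
  · rintro (rfl | rfl | rfl | rfl)
    exacts [⟨0, 0, by simp⟩, ⟨1, 0, by simp⟩, ⟨0, 1, by simp⟩, ⟨1, 1, by simp⟩]

theorem exists_equiv_of_three {a b c : Fin 4 → ZMod 2} (ha : a ≠ 0)
    (hb : b ∉ span (ZMod 2) {a}) (hc : c ∉ span (ZMod 2) {a, b}) :
    ∃ g : (Fin 4 → ZMod 2) ≃ₗ[ZMod 2] (Fin 4 → ZMod 2),
      g (unitVec 0) = a ∧ g (unitVec 1) = b ∧ g (unitVec 2) = c := by
  classical
  obtain ⟨d, hd⟩ := exists_notMem_span {a, b, c} (Finset.card_le_three.trans_lt (by norm_num))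
  obtain ⟨g, h0, h1, h2, -⟩ := exists_equiv_of_notMem_span ha hb hc (by simpa using hd)
  exact ⟨g, h0, h1, h2⟩

theorem exists_equiv_of_two {a b : Fin 4 → ZMod 2} (ha : a ≠ 0)
    (hb : b ∉ span (ZMod 2) {a}) :
    ∃ g : (Fin 4 → ZMod 2) ≃ₗ[ZMod 2] (Fin 4 → ZMod 2),
      g (unitVec 0) = a ∧ g (unitVec 1) = b := by
  classical
  obtain ⟨c, hc⟩ := exists_notMem_span {a, b} (Finset.card_le_two.trans_lt (by norm_num))
  obtain ⟨g, h0, h1, -⟩ := exists_equiv_of_three ha hb (by simpa using hc)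
  exact ⟨g, h0, h1⟩

theorem exists_equiv_of_one {a : Fin 4 → ZMod 2} (ha : a ≠ 0) :
    ∃ g : (Fin 4 → ZMod 2) ≃ₗ[ZMod 2] (Fin 4 → ZMod 2), g (unitVec 0) = a := by
  classical
  obtain ⟨b, hb⟩ := exists_notMem_span {a} (by simp)
  obtain ⟨g, h0, -⟩ := exists_equiv_of_two ha (by simpa using hb)
  exact ⟨g, h0⟩

end Frames

section Models

/-- The vector whose coordinates are the binary digits of a number. -/
def code (v : Fin 4 → ZMod 2) : ℕ :=
  (v 0).val + 2 * (v 1).val + 4 * (v 2).val + 8 * (v 3).val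

/-- The ten partitions of the vectors of `F₂⁴`, listed by the binary code of the vector. Colour `0`
marks the loops, the other colours mark the parallel classes. From the fifth partition on, the
vectors of a colour at least `10` are parallel to no other vector. -/
def colorTable : Fin 10 → List ℕ := ![
  [0, 0, 0, 0, 1, 1, 1, 1, 2, 2, 2, 2, 3, 3, 3, 3],
  [0, 0, 1, 1, 2, 2, 3, 3, 4, 4, 5, 5, 6, 6, 7, 7],
  [0, 0, 1, 1, 1, 1, 1, 1, 2, 2, 3, 3, 4, 4, 5, 5],
  [0, 1, 1, 1, 1, 1, 1, 1, 18, 19, 20, 21, 22, 23, 24, 25],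
  [0, 11, 12, 13, 14, 15, 16, 17, 18, 19, 20, 21, 22, 23, 24, 25],
  [0, 1, 1, 1, 14, 15, 16, 17, 18, 19, 20, 21, 22, 23, 24, 25],
  [0, 1, 1, 1, 2, 15, 16, 17, 2, 19, 20, 21, 2, 23, 24, 25],
  [0, 1, 1, 1, 2, 3, 16, 17, 2, 19, 3, 21, 2, 23, 24, 3],
  [0, 1, 1, 1, 2, 3, 16, 4, 2, 4, 3, 21, 2, 23, 4, 3],
  [0, 1, 1, 1, 2, 3, 5, 4, 2, 4, 3, 5, 2, 5, 4, 3]]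

/-- The colour of a vector in the `i`-th partition. -/
def color (i : Fin 10) (v : Fin 4 → ZMod 2) : ℕ := (colorTable i).getD (code v) 0

/-- The parallelism of the `i`-th partition. -/
def ColorRel (i : Fin 10) (v w : Fin 4 → ZMod 2) : Prop :=
  color i v = 0 ∨ color i w = 0 ∨ color i v = color i w

instance (i : Fin 10) (v w : Fin 4 → ZMod 2) : Decidable (ColorRel i v w) :=
  inferInstanceAs (Decidable (color i v = 0 ∨ color i w = 0 ∨ color i v = color i w))

/-- Pairs of vectors generating the two-dimensional parallel classes of the last six partitions. -/
def lineGenerators : Fin 10 → List ((Fin 4 → ZMod 2) × (Fin 4 → ZMod 2)) := ![[], [], [], [], [],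
  [(unitVec 0, unitVec 1)],
  [(unitVec 0, unitVec 1), (unitVec 2, unitVec 3)],
  [(unitVec 0, unitVec 1), (unitVec 2, unitVec 3),
    (unitVec 0 + unitVec 2, unitVec 1 + unitVec 3)],
  [(unitVec 0, unitVec 1), (unitVec 2, unitVec 3),
    (unitVec 0 + unitVec 2, unitVec 1 + unitVec 3),
    (unitVec 0 + unitVec 3, unitVec 1 + unitVec 2 + unitVec 3)],
  [(unitVec 0, unitVec 1), (unitVec 2, unitVec 3),
    (unitVec 0 + unitVec 2, unitVec 1 + unitVec 3),
    (unitVec 0 + unitVec 3, unitVec 1 + unitVec 2 + unitVec 3),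
    (unitVec 1 + unitVec 2, unitVec 0 + unitVec 1 + unitVec 3)]]

/-- Membership in the span of two vectors, in a decidable form. -/
def InPlane (a b c : Fin 4 → ZMod 2) : Prop := c = 0 ∨ c = a ∨ c = b ∨ c = a + b

instance (a b c : Fin 4 → ZMod 2) : Decidable (InPlane a b c) :=
  inferInstanceAs (Decidable (c = 0 ∨ c = a ∨ c = b ∨ c = a + b))

/-- `x` and `y` span a line all of whose points are singleton classes of the `i`-th partition. -/
abbrev IsFreeLine (i : Fin 10) (x y : Fin 4 → ZMod 2) : Prop :=
  x ≠ y ∧ 10 ≤ color i x ∧ 10 ≤ color i y ∧ 10 ≤ color i (x + y)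

theorem color_add : ∀ (i : Fin 10) (v w : Fin 4 → ZMod 2),
    (color i v = 0 → color i (v + w) = color i w) ∧
    (color i v = color i w → color i (v + w) = 0 ∨ color i (v + w) = color i v) := by
  decide +kernel

theorem isParallelism_colorRel (i : Fin 10) : IsParallelism (ColorRel i) where
  refl v := Or.inr (Or.inr rfl)
  symm {v w} H := by
    rcases H with H | H | H
    exacts [Or.inr (Or.inl H), Or.inl H, Or.inr (Or.inr H.symm)]
  add {v w w'} H H' := by
    have h1 := color_add i w w'
    have h2 := color_add i w' w
    rw [add_comm w' w] at h2
    unfold ColorRel at *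
    omega
  trans {u v w} H H' := by
    by_cases h0 : color i v = 0
    · exact Or.inl fun _ => Or.inl h0
    · right
      unfold ColorRel at *
      omega
  nontriv := by
    revert i
    decide +kernel

theorem colorRel_invariants_injective :
    Function.Injective fun i : Fin 10 =>
      (((Finset.univ : Finset (Fin 4 → ZMod 2)).filter fun v => ∀ w, ColorRel i v w).card,
        ((Finset.univ : Finset ((Fin 4 → ZMod 2) × (Fin 4 → ZMod 2))).filter
          fun p => ColorRel i p.1 p.2).card) := by
  decide +kernel

theorem colorRel_two_loops : ∀ x y : Fin 4 → ZMod 2, (ColorRel 0 x y →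
      InPlane (unitVec 0) (unitVec 1) x ∨ InPlane (unitVec 0) (unitVec 1) y ∨
        InPlane (unitVec 0) (unitVec 1) (x + y)) ∧
    (¬ ColorRel 0 x y → ∀ i : Fin 4, ∃ s, unitVec i = comb (unitVec 0) (unitVec 1) x y s) := by
  decide +kernel

theorem colorRel_one_loop : ∀ x y : Fin 4 → ZMod 2, ColorRel 1 x y ↔
    (x = 0 ∨ x = unitVec 0) ∨ (y = 0 ∨ y = unitVec 0) ∨ x + y = 0 ∨ x + y = unitVec 0 := by
  decide +kernel

theorem colorRel_one_loop_plane : ∀ x y : Fin 4 → ZMod 2, ColorRel 2 x y ↔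
    (x = 0 ∨ x = unitVec 0) ∨ (y = 0 ∨ y = unitVec 0) ∨ (x + y = 0 ∨ x + y = unitVec 0) ∨
      (x 3 = 0 ∧ y 3 = 0) := by
  decide +kernel

theorem colorRel_hyperplane : ∀ x y : Fin 4 → ZMod 2, ColorRel 3 x y ↔
    x = 0 ∨ y = 0 ∨ x + y = 0 ∨ (x 3 = 0 ∧ y 3 = 0) := by
  decide +kernel

theorem colorRel_lines : ∀ (i : Fin 10) (x y : Fin 4 → ZMod 2), 4 ≤ i → ColorRel i x y →
    x = 0 ∨ y = 0 ∨ x = y ∨ ∃ p ∈ lineGenerators i, InPlane p.1 p.2 x ∧ InPlane p.1 p.2 y := by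
  decide +kernel

theorem color_zero : ∀ i : Fin 10, color i 0 = 0 := by
  decide

theorem not_colorRel_add : ∀ (i : Fin 10) (x y : Fin 4 → ZMod 2), 4 ≤ i → ¬ ColorRel i x y →
    ¬ ColorRel i (x + y) x := by
  decide +kernel

theorem exists_same_color : ∀ (i : Fin 10) (x y : Fin 4 → ZMod 2), 4 ≤ i → ¬ ColorRel i x y →
    color i x < 10 → ∃ w, color i w = color i x ∧ ¬ InPlane x y w := by
  decide +kernel

theorem comb_eq_zero_of_isFreeLine_five : ∀ x y s : Fin 4 → ZMod 2, IsFreeLine 5 x y →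
    comb (unitVec 0) (unitVec 1) x y s = 0 → s = 0 := by
  decide +kernel

theorem comb_eq_zero_of_isFreeLine_six : ∀ x y s : Fin 4 → ZMod 2, IsFreeLine 6 x y →
    comb (comb (unitVec 0) (unitVec 1) 0 0 x) (comb (unitVec 0) (unitVec 1) 0 0 y)
      (comb 0 0 (unitVec 2) (unitVec 3) x) (comb 0 0 (unitVec 2) (unitVec 3) y) s = 0 →
    s = 0 := by
  decide +kernel

theorem inPlane_of_isFreeLine_seven : ∀ x y : Fin 4 → ZMod 2, IsFreeLine 7 x y →
    (InPlane x y (unitVec 0 + unitVec 3) ∧ InPlane x y (unitVec 1 + unitVec 2 + unitVec 3)) ∨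
    (InPlane x y (unitVec 1 + unitVec 2) ∧ InPlane x y (unitVec 0 + unitVec 2 + unitVec 3)) := by
  decide +kernel

theorem inPlane_of_isFreeLine_eight : ∀ x y : Fin 4 → ZMod 2, IsFreeLine 8 x y →
    InPlane x y (unitVec 1 + unitVec 2) ∧ InPlane x y (unitVec 0 + unitVec 1 + unitVec 3) := by
  decide +kernel

theorem color_nine_lt : ∀ x : Fin 4 → ZMod 2, color 9 x < 10 := by
  decide +kernel

end Models

section Classification

/-- `R` becomes one of the ten explicit parallelisms after a change of basis. -/
def Classified (R : (Fin 4 → ZMod 2) → (Fin 4 → ZMod 2) → Prop) : Prop :=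
  ∃ (i : Fin 10) (g : (Fin 4 → ZMod 2) ≃ₗ[ZMod 2] (Fin 4 → ZMod 2)),
    ∀ x y, R (g x) (g y) ↔ ColorRel i x y

variable {R : (Fin 4 → ZMod 2) → (Fin 4 → ZMod 2) → Prop}

theorem Classified.of_comap (g : (Fin 4 → ZMod 2) ≃ₗ[ZMod 2] (Fin 4 → ZMod 2))
    (H : Classified fun x y => R (g x) (g y)) : Classified R := by
  obtain ⟨i, g', hg'⟩ := H
  exact ⟨i, g'.trans g, hg'⟩

theorem Classified.of_iff (i : Fin 10) (H : ∀ x y, R x y ↔ ColorRel i x y) : Classified R :=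
  ⟨i, LinearEquiv.refl _ _, H⟩

theorem forall_comap_iff (g : (Fin 4 → ZMod 2) ≃ₗ[ZMod 2] (Fin 4 → ZMod 2))
    (v : Fin 4 → ZMod 2) : (∀ w, R (g v) (g w)) ↔ ∀ w, R (g v) w :=
  g.surjective.forall.symm

theorem IsParallelism.comap (h : IsParallelism R)
    (g : (Fin 4 → ZMod 2) ≃ₗ[ZMod 2] (Fin 4 → ZMod 2)) :
    IsParallelism fun x y => R (g x) (g y) where
  refl v := h.refl _
  symm := h.symm
  add H H' := by
    rw [map_add]
    exact h.add H H'
  trans H H' := (h.trans H H').imp_left fun H x => H _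
  nontriv := by
    obtain ⟨u, v, huv⟩ := h.nontriv
    exact ⟨g.symm u, g.symm v, by simpa using huv⟩

theorem InPlane.mem_span {a b c : Fin 4 → ZMod 2} (hc : InPlane a b c) :
    c ∈ span (ZMod 2) {a, b} :=
  mem_span_pair_zmod_two.2 hc

namespace IsParallelism

theorem zero_left (h : IsParallelism R) (x : Fin 4 → ZMod 2) : R 0 x :=
  h.symm (h.zero_right x)

theorem loops_ne_top (h : IsParallelism R) : h.loops ≠ ⊤ := by
  intro H
  obtain ⟨u, v, huv⟩ := h.nontriv
  exact huv ((H ▸ mem_top : u ∈ h.loops) v)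

theorem loop_of_block_eq_top (h : IsParallelism R) {u : Fin 4 → ZMod 2}
    (H : h.block u = ⊤) (x : Fin 4 → ZMod 2) : R u x :=
  (H ▸ mem_top : x ∈ h.block u)

theorem classified_of_two_loops (h : IsParallelism R) (h0 : ∀ x, R (unitVec 0) x)
    (h1 : ∀ x, R (unitVec 1) x) : Classified R := by
  have hL : ∀ x, InPlane (unitVec 0) (unitVec 1) x → ∀ y, R x y := by
    intro x hx
    have : span (ZMod 2) {unitVec 0, unitVec 1} ≤ h.loops := by
      rw [span_le]
      rintro z (rfl | rfl)
      exacts [h0, h1]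
    exact this hx.mem_span
  refine Classified.of_iff 0 fun x y => ⟨fun hxy => ?_, fun hxy => ?_⟩
  · by_contra hc
    have key := (colorRel_two_loops x y).2 hc
    have top : ∀ S : Submodule (ZMod 2) (Fin 4 → ZMod 2), unitVec 0 ∈ S → unitVec 1 ∈ S →
        x ∈ S → y ∈ S → S = ⊤ := by
      intro S m0 m1 mx my
      have : ∀ i : Fin 4, unitVec i ∈ S := by
        intro i
        obtain ⟨s, hs⟩ := key i
        rw [hs]
        exact add_mem (add_mem (add_mem (S.smul_mem _ m0) (S.smul_mem _ m1)) (S.smul_mem _ mx))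
          (S.smul_mem _ my)
      exact eq_top_of_unitVec_mem (this 0) (this 1) (this 2) (this 3)
    have hx := top (h.block x) (h.symm (h0 x)) (h.symm (h1 x)) (h.refl x) hxy
    have hy := top (h.block y) (h.symm (h0 y)) (h.symm (h1 y)) (h.symm hxy) (h.refl y)
    exact h.loops_ne_top (top h.loops h0 h1 (h.loop_of_block_eq_top hx)
      (h.loop_of_block_eq_top hy))
  · rcases (colorRel_two_loops x y).1 hxy with H | H | H
    · exact hL x H y
    · exact h.symm (hL y H x)
    · exact h.rel_of_add_loop (hL _ H)

theorem classified_of_one_loop (h : IsParallelism R)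
    (h0 : ∀ v, (∀ w, R v w) ↔ v = 0 ∨ v = unitVec 0)
    (h1 : ∀ x y, R x y → (∀ w, R x w) ∨ (∀ w, R y w) ∨ ∀ w, R (x + y) w) :
    Classified R := by
  refine Classified.of_iff 1 fun x y => ?_
  rw [colorRel_one_loop, ← h0, ← h0, ← h0]
  refine ⟨h1 x y, ?_⟩
  rintro (H | H | H)
  exacts [H y, h.symm (H x), h.rel_of_add_loop H]

theorem rel_of_apply_three_eq_zero (h : IsParallelism R) {u x : Fin 4 → ZMod 2}
    (h0 : R u (unitVec 0)) (h1 : R u (unitVec 1)) (h2 : R u (unitVec 2)) (hx : x 3 = 0) :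
    R u x := by
  rw [← comb_unitVec_self x, comb, hx, zero_smul, add_zero]
  exact h.add (h.add (h.smul _ h0) (h.smul _ h1)) (h.smul _ h2)

/-- If the hyperplane spanned by the first three basis vectors is a parallel class together with
the loops, then parallel vectors outside of this class differ by a loop. -/
theorem iff_of_hyperplane (h : IsParallelism R) {u : Fin 4 → ZMod 2}
    (hu : ¬ ∀ x, R u x) (h0 : R u (unitVec 0)) (h1 : R u (unitVec 1)) (h2 : R u (unitVec 2))
    (x y : Fin 4 → ZMod 2) :
    R x y ↔ (∀ w, R x w) ∨ (∀ w, R y w) ∨ (∀ w, R (x + y) w) ∨ (x 3 = 0 ∧ y 3 = 0) := by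
  have hW : ∀ {z}, z 3 = 0 → R u z := fun hz => h.rel_of_apply_three_eq_zero h0 h1 h2 hz
  have mixed : ∀ a b, R a b → a 3 = 0 → b 3 = 1 → ∀ w, R a w := by
    intro a b hab ha hb
    by_contra hna
    have hau := h.symm (hW ha)
    have hu' : h.block u = ⊤ := by
      have hub : R u b := h.trans_of_not_loop hna hau hab
      refine eq_top_of_unitVec_mem h0 h1 h2 ?_
      have e : unitVec 3 = (unitVec 3 + b) + b := by
        rw [add_assoc, ZModModule.add_self, add_zero]
      rw [e]
      refine h.add (hW ?_) hub
      rw [Pi.add_apply, hb]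
      decide
    exact hu (h.loop_of_block_eq_top hu')
  constructor
  · intro hxy
    rcases zmod_two_cases (x 3) with hx | hx <;> rcases zmod_two_cases (y 3) with hy | hy
    · exact Or.inr (Or.inr (Or.inr ⟨hx, hy⟩))
    · exact Or.inl (mixed x y hxy hx hy)
    · exact Or.inr (Or.inl (mixed y x (h.symm hxy) hy hx))
    · refine Or.inr (Or.inr (Or.inl (mixed (x + y) x ?_ ?_ hx)))
      · exact h.symm (h.add (h.refl x) hxy)
      · rw [Pi.add_apply, hx, hy]
        rfl
  · rintro (H | H | H | ⟨hx, hy⟩)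
    exacts [H y, h.symm (H x), h.rel_of_add_loop H, h.trans_of_not_loop hu (hW hx) (hW hy)]

theorem classified_of_one_loop_plane (h : IsParallelism R)
    (h0 : ∀ v, (∀ w, R v w) ↔ v = 0 ∨ v = unitVec 0) (h1 : R (unitVec 1) (unitVec 2)) :
    Classified R := by
  refine Classified.of_iff 2 fun x y => ?_
  rw [colorRel_one_loop_plane, ← h0, ← h0, ← h0]
  refine h.iff_of_hyperplane (u := unitVec 1) ?_ (h.symm ((h0 _).2 (Or.inr rfl) _)) (h.refl _) h1
    x y
  rw [h0]
  decide

theorem classified_of_hyperplane (h : IsParallelism R)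
    (h0 : ∀ v, (∀ w, R v w) → v = 0) (h1 : R (unitVec 0) (unitVec 1))
    (h2 : R (unitVec 0) (unitVec 2)) : Classified R := by
  have h0' : ∀ v, (∀ w, R v w) ↔ v = 0 := fun v =>
    ⟨h0 v, by rintro rfl; exact h.zero_left⟩
  refine Classified.of_iff 3 fun x y => ?_
  rw [colorRel_hyperplane, ← h0', ← h0', ← h0']
  refine h.iff_of_hyperplane (u := unitVec 0) ?_ (h.refl _) h1 h2 x y
  rw [h0']
  decide

end IsParallelism

/-- A parallelism without loops all of whose classes span subspaces of dimension at most two. -/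
structure IsPartialSpread (R : (Fin 4 → ZMod 2) → (Fin 4 → ZMod 2) → Prop) : Prop
    extends IsParallelism R where
  inPlane : ∀ {a b c}, a ≠ 0 → b ≠ 0 → b ≠ a → R a b → R a c → InPlane a b c

namespace IsPartialSpread

theorem not_loop (h : IsPartialSpread R) {v : Fin 4 → ZMod 2} (hv : v ≠ 0) :
    ¬ ∀ w, R v w := by
  intro H
  obtain ⟨g, rfl⟩ := exists_equiv_of_one hv
  have := h.inPlane (c := g (unitVec 2)) hv (b := g (unitVec 1))
    (by rw [Ne, map_eq_zero_iff _ g.injective]; decide) (g.injective.ne (by decide)) (H _) (H _)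
  simp only [InPlane, ← map_add, map_eq_zero_iff _ g.injective, g.injective.eq_iff] at this
  revert this
  decide

theorem comap (h : IsPartialSpread R)
    (g : (Fin 4 → ZMod 2) ≃ₗ[ZMod 2] (Fin 4 → ZMod 2)) :
    IsPartialSpread fun x y => R (g x) (g y) where
  toIsParallelism := h.toIsParallelism.comap g
  inPlane {a b c} ha hb hba hab hac := by
    have := h.inPlane (by simpa using ha) (by simpa using hb) (by simpa using hba) hab hac
    simpa only [InPlane, ← map_add, map_eq_zero_iff _ g.injective, g.injective.eq_iff] using this

theorem rel_of_inPlane (h : IsPartialSpread R) {a b x y : Fin 4 → ZMod 2} (hab : R a b)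
    (hx : InPlane a b x) (hy : InPlane a b y) : R x y :=
  h.rel_of_mem_span_pair hab hx.mem_span hy.mem_span

theorem classified_or_exists_isFreeLine (h : IsPartialSpread R) (i : Fin 10) (hi : 4 ≤ i)
    (hR : ∀ p ∈ lineGenerators i, R p.1 p.2) :
    Classified R ∨ ∃ x y, R x y ∧ IsFreeLine i x y := by
  have le : ∀ {x y}, ColorRel i x y → R x y := by
    intro x y hxy
    rcases colorRel_lines i x y hi hxy with rfl | rfl | rfl | ⟨p, hp, hx, hy⟩
    exacts [h.zero_left _, h.zero_right _, h.refl _, h.rel_of_inPlane (hR p hp) hx hy]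
  have free : ∀ {x y}, R x y → ¬ ColorRel i x y → 10 ≤ color i x := by
    intro x y hxy hc
    by_contra hx
    obtain ⟨w, hw, hw'⟩ := exists_same_color i x y hi hc (not_le.1 hx)
    refine hw' (h.inPlane ?_ ?_ ?_ hxy (le (Or.inr (Or.inr hw.symm))))
    · rintro rfl
      exact hc (Or.inl (color_zero i))
    · rintro rfl
      exact hc (Or.inr (Or.inl (color_zero i)))
    · rintro rfl
      exact hc (Or.inr (Or.inr rfl))
  by_cases H : ∀ x y, R x y → ColorRel i x y
  · exact Or.inl (Classified.of_iff i fun x y => ⟨H x y, le⟩)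
  · push Not at H
    obtain ⟨x, y, hxy, hc⟩ := H
    refine Or.inr ⟨x, y, hxy, ?_, free hxy hc, free (h.symm hxy) ?_, free (y := x) ?_ ?_⟩
    · rintro rfl
      exact hc (Or.inr (Or.inr rfl))
    · exact fun H => hc ((isParallelism_colorRel i).symm H)
    · exact h.symm (h.add (h.refl x) hxy)
    · exact not_colorRel_add i x y hi hc

theorem classified_of_five_lines (h : IsPartialSpread R)
    (hR : ∀ p ∈ lineGenerators 9, R p.1 p.2) : Classified R := by
  refine (h.classified_or_exists_isFreeLine 9 (by decide) hR).resolve_right ?_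
  rintro ⟨x, y, -, -, hx, -⟩
  exact (color_nine_lt x).not_ge hx

theorem classified_of_four_lines (h : IsPartialSpread R)
    (hR : ∀ p ∈ lineGenerators 8, R p.1 p.2) : Classified R := by
  obtain H | ⟨x, y, hxy, hf⟩ := h.classified_or_exists_isFreeLine 8 (by decide) hR
  · exact H
  · obtain ⟨h1, h2⟩ := inPlane_of_isFreeLine_eight x y hf
    have := h.rel_of_inPlane hxy h1 h2
    refine h.classified_of_five_lines ?_
    simp_all [lineGenerators]

theorem classified_of_three_lines (h : IsPartialSpread R)
    (hR : ∀ p ∈ lineGenerators 7, R p.1 p.2) : Classified R := by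
  obtain H | ⟨x, y, hxy, hf⟩ := h.classified_or_exists_isFreeLine 7 (by decide) hR
  · exact H
  · simp only [lineGenerators, Fin.isValue] at hR
    obtain ⟨h1, h2⟩ | ⟨h1, h2⟩ := inPlane_of_isFreeLine_seven x y hf
    · have := h.rel_of_inPlane hxy h1 h2
      refine h.classified_of_four_lines ?_
      simp_all [lineGenerators]
    · have := h.rel_of_inPlane hxy h1 h2
      obtain ⟨g, g0, g1, g2, g3⟩ := exists_equiv_of_comb (a := unitVec 1) (b := unitVec 0)
        (c := unitVec 3) (d := unitVec 2) (by decide +kernel)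
      refine Classified.of_comap g ((h.comap g).classified_of_four_lines ?_)
      have hs := @h.symm
      simp_all [lineGenerators]
      rw [add_right_comm]
      exact this

theorem classified_of_two_lines (h : IsPartialSpread R)
    (hR : ∀ p ∈ lineGenerators 6, R p.1 p.2) : Classified R := by
  obtain H | ⟨x, y, hxy, hf⟩ := h.classified_or_exists_isFreeLine 6 (by decide) hR
  · exact H
  · obtain ⟨g, g0, g1, g2, g3⟩ :=
      exists_equiv_of_comb fun s => comb_eq_zero_of_isFreeLine_six x y s hf
    refine Classified.of_comap g ((h.comap g).classified_of_three_lines ?_)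
    have h0 := hR (unitVec 0, unitVec 1) (by simp [lineGenerators])
    have h2 := hR (unitVec 2, unitVec 3) (by simp [lineGenerators])
    have m0 : ∀ s, comb (unitVec 0) (unitVec 1) 0 0 s ∈
        span (ZMod 2) {unitVec 0, unitVec 1} := fun s =>
      mem_span_pair.2 ⟨s 0, s 1, by simp [comb]⟩
    have m2 : ∀ s, comb 0 0 (unitVec 2) (unitVec 3) s ∈
        span (ZMod 2) {unitVec 2, unitVec 3} := fun s =>
      mem_span_pair.2 ⟨s 2, s 3, by simp [comb]⟩
    have e : ∀ s, comb (unitVec 0) (unitVec 1) 0 0 s + comb 0 0 (unitVec 2) (unitVec 3) s = s := by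
      intro s
      conv_rhs => rw [← comb_unitVec_self s]
      simp [comb, add_assoc]
    have h0' := h.rel_of_mem_span_pair h0 (m0 x) (m0 y)
    have h2' := h.rel_of_mem_span_pair h2 (m2 x) (m2 y)
    simp [lineGenerators, g0, g1, g2, g3, e, h0', h2', hxy]

theorem classified_of_one_line (h : IsPartialSpread R)
    (hR : ∀ p ∈ lineGenerators 5, R p.1 p.2) : Classified R := by
  obtain H | ⟨x, y, hxy, hf⟩ := h.classified_or_exists_isFreeLine 5 (by decide) hR
  · exact H
  · obtain ⟨g, g0, g1, g2, g3⟩ :=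
      exists_equiv_of_comb fun s => comb_eq_zero_of_isFreeLine_five x y s hf
    refine Classified.of_comap g ((h.comap g).classified_of_two_lines ?_)
    simp_all [lineGenerators]

theorem classified (h : IsPartialSpread R) : Classified R := by
  obtain H | ⟨x, y, hxy, hf⟩ := h.classified_or_exists_isFreeLine 4 (by decide)
    (by simp [lineGenerators])
  · exact H
  · have hx : x ≠ 0 := by
      rintro rfl
      exact absurd hf.2.1 (by decide)
    have hy : y ≠ 0 := by
      rintro rfl
      exact absurd hf.2.2.1 (by decide)
    obtain ⟨g, g0, g1⟩ := exists_equiv_of_two hx (b := y) (by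
      rw [mem_span_singleton_zmod_two]
      exact not_or.2 ⟨hy, hf.1.symm⟩)
    refine Classified.of_comap g ((h.comap g).classified_of_one_line ?_)
    simp_all [lineGenerators]

end IsPartialSpread

theorem IsParallelism.classified (h : IsParallelism R) : Classified R := by
  by_cases hl : ∃ l, l ≠ 0 ∧ ∀ w, R l w
  · obtain ⟨l, hl0, hl⟩ := hl
    by_cases hl' : ∃ l', l' ≠ 0 ∧ l' ≠ l ∧ ∀ w, R l' w
    · obtain ⟨l', hl'0, hne, hl'⟩ := hl'
      obtain ⟨g, rfl, rfl⟩ := exists_equiv_of_two hl0 (b := l') (by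
        rw [mem_span_singleton_zmod_two]
        exact not_or.2 ⟨hl'0, hne⟩)
      exact Classified.of_comap g ((h.comap g).classified_of_two_loops (fun _ => hl _)
        fun _ => hl' _)
    · have loop_iff : ∀ v, (∀ w, R v w) ↔ v = 0 ∨ v = l := by
        intro v
        constructor
        · intro hv
          by_contra! H
          exact hl' ⟨v, H.1, H.2, hv⟩
        · rintro (rfl | rfl)
          exacts [h.zero_left, hl]
      have comap_iff : ∀ g : (Fin 4 → ZMod 2) ≃ₗ[ZMod 2] (Fin 4 → ZMod 2), g (unitVec 0) = l →
          ∀ v, (∀ w, R (g v) (g w)) ↔ v = 0 ∨ v = unitVec 0 := by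
        intro g hg v
        rw [forall_comap_iff, loop_iff, ← hg, map_eq_zero_iff _ g.injective, g.injective.eq_iff]
      by_cases hxy : ∀ x y, R x y → (∀ w, R x w) ∨ (∀ w, R y w) ∨ ∀ w, R (x + y) w
      · obtain ⟨g, hg⟩ := exists_equiv_of_one hl0
        refine Classified.of_comap g ((h.comap g).classified_of_one_loop (comap_iff g hg) ?_)
        intro x y H
        have := hxy _ _ H
        rw [← map_add] at this
        simpa only [forall_comap_iff] using this
      · simp only [loop_iff] at hxy
        push Not at hxy
        obtain ⟨x, y, hR, ⟨hx0, hxl⟩, ⟨hy0, hyl⟩, hxy0, hxyl⟩ := hxy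
        obtain ⟨g, hg, rfl, rfl⟩ := exists_equiv_of_three hl0 (b := x) (c := y)
          (by
            rw [mem_span_singleton_zmod_two]
            exact not_or.2 ⟨hx0, hxl⟩)
          (by
            rw [mem_span_pair_zmod_two]
            rintro (rfl | rfl | rfl | rfl)
            · exact hy0 rfl
            · exact hyl rfl
            · exact hxy0 (ZModModule.add_self _)
            · exact hxyl (by rw [add_left_comm, ZModModule.add_self, add_zero]))
        exact Classified.of_comap g ((h.comap g).classified_of_one_loop_plane (comap_iff g hg) hR)
  · have hl' : ∀ v, (∀ w, R v w) → v = 0 := by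
      intro v hv
      by_contra H
      exact hl ⟨v, H, hv⟩
    by_cases hp : ∀ a b c, a ≠ 0 → b ≠ 0 → b ≠ a → R a b → R a c → InPlane a b c
    · exact IsPartialSpread.classified ⟨h, @hp⟩
    · push Not at hp
      obtain ⟨a, b, c, ha, hb, hba, hab, hac, hc⟩ := hp
      obtain ⟨g, rfl, rfl, rfl⟩ := exists_equiv_of_three ha (b := b) (c := c)
        (by
          rw [mem_span_singleton_zmod_two]
          exact not_or.2 ⟨hb, hba⟩)
        (by
          rw [mem_span_pair_zmod_two]
          exact hc)
      refine Classified.of_comap g ((h.comap g).classified_of_hyperplane ?_ hab hac)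
      intro v hv
      rw [forall_comap_iff] at hv
      simpa using hl' _ hv

end Classification

/-- there are exactly 10 isomorphism classes of q-matroids of
rank 2 on a 4-dimensional vector space over F₂. -/
theorem stmt14 :
    Nat.card (Quot (fun r₁ r₂ :
        {r : Submodule (ZMod 2) (Fin 4 → ZMod 2) → ℕ // IsQMatroid r ∧ r ⊤ = 2} =>
      ∃ g : (Fin 4 → ZMod 2) ≃ₗ[ZMod 2] (Fin 4 → ZMod 2),
        ∀ X : Submodule (ZMod 2) (Fin 4 → ZMod 2),
          r₁.1 X = r₂.1 (Submodule.map g.toLinearMap X))) = 10 := by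
  classical
  let S := {r : Submodule (ZMod 2) (Fin 4 → ZMod 2) → ℕ // IsQMatroid r ∧ r ⊤ = 2}
  let iso : S → S → Prop := fun r₁ r₂ =>
    ∃ g : (Fin 4 → ZMod 2) ≃ₗ[ZMod 2] (Fin 4 → ZMod 2),
      ∀ X : Submodule (ZMod 2) (Fin 4 → ZMod 2), r₁.1 X = r₂.1 (Submodule.map g.toLinearMap X)
  let model : Fin 10 → S := fun i => ⟨parallelRank (ColorRel i),
    (isParallelism_colorRel i).isQMatroid, (isParallelism_colorRel i).parallelRank_top⟩
  have model_iff : ∀ i v w, Parallel (model i).1 v w ↔ ColorRel i v w := fun i =>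
    (isParallelism_colorRel i).parallel_parallelRank
  let inv : Quot iso → ℕ × ℕ := Quot.lift
    (fun r => ((Finset.univ.filter fun v => ∀ w, Parallel r.1 v w).card,
      (Finset.univ.filter fun p : (Fin 4 → ZMod 2) × (Fin 4 → ZMod 2) =>
        Parallel r.1 p.1 p.2).card)) (by
    rintro r₁ r₂ ⟨g, hg⟩
    have key := parallel_iff_of_rank_eq_map g hg
    refine congrArg₂ Prod.mk ?_ ?_
    · refine Finset.card_equiv g.toEquiv fun v => ?_
      simp only [Finset.mem_filter, Finset.mem_univ, true_and, key]
      exact forall_comap_iff g v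
    · refine Finset.card_equiv (g.toEquiv.prodCongr g.toEquiv) fun p => ?_
      simp only [Finset.mem_filter, Finset.mem_univ, true_and, key]
      rfl)
  have bij : Function.Bijective fun i => Quot.mk iso (model i) := by
    constructor
    · intro i j hij
      apply colorRel_invariants_injective
      have := congrArg inv hij
      simp only [inv, model_iff] at this
      convert this
    · rintro ⟨r, hr, htop⟩
      obtain ⟨i, g, hg⟩ := (hr.isParallelism htop).classified
      refine ⟨i, Quot.sound ⟨g, fun X => ?_⟩⟩
      exact (model i).2.1.rank_eq_map_of_parallel_iff hr (model i).2.2 htop g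
        (fun v w => (model_iff i v w).trans (hg v w).symm) X
  have := Nat.card_eq_of_bijective _ bij
  rw [Nat.card_fin] at this
  exact this.symm
end
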